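/- Let (Λ,F) be an ℝ-building and let C_∞ and D_∞ be two adjacent chambers at infinity. If for a point β ∈ Λ the sectors C_β and D_β based at β locally coincide (have the same germ at β), then there exists l > 0 such that for every point γ ∈ Λ with d(β,γ) < l, the sectors C_γ and D_γ based at γ locally coincide. -/

import Mathlib

open Set

noncomputable section

/-- The model space `𝔸`: Euclidean `n`-space. -/
abbrev ModelSpace (n : ℕ) : Type := EuclideanSpace ℝ (Fin n)

/-- A linear reflection of the model space: an involutive isometry, different from the
identity, whose fixed-point set is a linear hyperplane (the kernel of a nonzero linear
functional). -/
def IsLinearReflection {n : ℕ} (s : ModelSpace n ≃ᵢ ModelSpace n) : Prop :=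
  s * s = 1 ∧ s ≠ 1 ∧
    ∃ p : ModelSpace n →ₗ[ℝ] ℝ, p ≠ 0 ∧ {x | s x = x} = {x | p x = 0}

/-- A spherical Coxeter system of rank `n`, realized as a finite reflection group acting
on the model space `ℝⁿ`: a finite set `S` of linear reflections generating a finite
group `W̄`. -/
structure SphericalCoxeterSystem (n : ℕ) where
  S : Set (ModelSpace n ≃ᵢ ModelSpace n)
  finiteS : S.Finite
  refl : ∀ s ∈ S, IsLinearReflection s
  finiteW : Finite ↥(Subgroup.closure S)

namespace SphericalCoxeterSystem

variable {n : ℕ}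

/-- The finite reflection group `W̄` generated by `S`. -/
def Wbar (cs : SphericalCoxeterSystem n) : Subgroup (ModelSpace n ≃ᵢ ModelSpace n) :=
  Subgroup.closure cs.S

/-- A translation of the model space. -/
def IsTranslation (t : ModelSpace n ≃ᵢ ModelSpace n) : Prop :=
  ∃ v : ModelSpace n, ∀ x, t x = x + v

/-- The group `W` of affine transformations generated by `W̄` and all translations. -/
def W (cs : SphericalCoxeterSystem n) : Subgroup (ModelSpace n ≃ᵢ ModelSpace n) :=
  Subgroup.closure (cs.S ∪ {t | IsTranslation t})

/-- An affine reflection: a `W`-conjugate of a generator in `S`. -/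
def IsAffineReflection (cs : SphericalCoxeterSystem n)
    (r : ModelSpace n ≃ᵢ ModelSpace n) : Prop :=
  ∃ s ∈ cs.S, ∃ w ∈ cs.W, r = w * s * w⁻¹

/-- A wall of the model space: the fixed-point set of an affine reflection. -/
def IsModelWall (cs : SphericalCoxeterSystem n) (M : Set (ModelSpace n)) : Prop :=
  ∃ r, cs.IsAffineReflection r ∧ M = {x | r x = x}

/-- A half-apartment of the model space: a closed half-space `H` bounded by the
wall `M` (fixed-point set of the affine reflection `r`). -/
def IsModelHalf (cs : SphericalCoxeterSystem n) (M H : Set (ModelSpace n)) : Prop :=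
  ∃ r, cs.IsAffineReflection r ∧ M = {x | r x = x} ∧
    IsClosed H ∧ Convex ℝ H ∧ H ∪ (⇑r '' H) = univ ∧ H ∩ (⇑r '' H) = M

/-- A sector-face of the model space based at `x`: a closed cell of the arrangement of
all walls through `x` (for each wall through `x` one chooses either the wall itself or
one of its two half-apartments, and takes the intersection of the choices). -/
def IsModelSectorFace (cs : SphericalCoxeterSystem n) (x : ModelSpace n)
    (F : Set (ModelSpace n)) : Prop :=
  F.Nonempty ∧ ∃ σ : Set (ModelSpace n) → Set (ModelSpace n),
    (∀ M, cs.IsModelWall M → x ∈ M → (σ M = M ∨ cs.IsModelHalf M (σ M))) ∧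
    F = ⋂ M ∈ {M | cs.IsModelWall M ∧ x ∈ M}, σ M

/-- A sector of the model space based at `x`: a maximal sector-face based at `x`. -/
def IsModelSector (cs : SphericalCoxeterSystem n) (x : ModelSpace n)
    (F : Set (ModelSpace n)) : Prop :=
  cs.IsModelSectorFace x F ∧ ∀ F', cs.IsModelSectorFace x F' → F ⊆ F' → F' = F

/-- A sector-panel of the model space based at `x`: a sector-face of codimension one. -/
def IsModelSectorPanel (cs : SphericalCoxeterSystem n) (x : ModelSpace n)
    (F : Set (ModelSpace n)) : Prop :=
  cs.IsModelSectorFace x F ∧ Module.finrank ℝ (affineSpan ℝ F).direction = n - 1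

/-- The word length on `W̄` with respect to the generating set `S`. -/
def wordLength (cs : SphericalCoxeterSystem n) (w : ModelSpace n ≃ᵢ ModelSpace n) : ℕ :=
  sInf {k | ∃ l : List (ModelSpace n ≃ᵢ ModelSpace n),
    l.length = k ∧ (∀ s ∈ l, s ∈ cs.S) ∧ l.prod = w}

/-- The longest element of `W̄`. -/
def IsLongest (cs : SphericalCoxeterSystem n) (w : ModelSpace n ≃ᵢ ModelSpace n) : Prop :=
  w ∈ cs.Wbar ∧ ∀ v ∈ cs.Wbar, cs.wordLength v ≤ cs.wordLength w

end SphericalCoxeterSystem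

section Building

variable {n : ℕ} {X : Type*} [MetricSpace X]

/-- Two subsets of a metric space are parallel if their Hausdorff distance is finite. -/
def Par (S T : Set X) : Prop := EMetric.hausdorffEdist S T ≠ ⊤

/-- Two sets locally coincide at `α` (have the same germ at `α`) if their intersection
is a neighbourhood of `α` in both of them. -/
def LocCoin (α : X) (F F' : Set X) : Prop :=
  F ∩ F' ∈ nhdsWithin α F ∧ F ∩ F' ∈ nhdsWithin α F'

variable (cs : SphericalCoxeterSystem n)

/-- An apartment: the image of a chart. -/
def IsApartment (Fc : Set (ModelSpace n → X)) (A : Set X) : Prop :=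
  ∃ f ∈ Fc, A = range f

/-- A sector-face based at `α` : the image under a chart of a sector-face of the model
space, with base point mapped to `α`. -/
def IsSectorFaceAt (Fc : Set (ModelSpace n → X)) (α : X) (F : Set X) : Prop :=
  ∃ f ∈ Fc, ∃ x s, cs.IsModelSectorFace x s ∧ f x = α ∧ F = f '' s

/-- A sector based at `α`. -/
def IsSectorAt (Fc : Set (ModelSpace n → X)) (α : X) (F : Set X) : Prop :=
  ∃ f ∈ Fc, ∃ x s, cs.IsModelSector x s ∧ f x = α ∧ F = f '' s

/-- A sector-panel based at `α`. -/
def IsSectorPanelAt (Fc : Set (ModelSpace n → X)) (α : X) (F : Set X) : Prop :=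
  ∃ f ∈ Fc, ∃ x s, cs.IsModelSectorPanel x s ∧ f x = α ∧ F = f '' s

/-- A sector-face. -/
def IsSectorFace (Fc : Set (ModelSpace n → X)) (F : Set X) : Prop :=
  ∃ α, IsSectorFaceAt cs Fc α F

/-- A sector. -/
def IsSector (Fc : Set (ModelSpace n → X)) (F : Set X) : Prop :=
  ∃ α, IsSectorAt cs Fc α F

/-- A sector-panel. -/
def IsSectorPanel (Fc : Set (ModelSpace n → X)) (F : Set X) : Prop :=
  ∃ α, IsSectorPanelAt cs Fc α F

/-- A wall: the image of a wall of the model space under a chart. -/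
def IsWall (Fc : Set (ModelSpace n → X)) (M : Set X) : Prop :=
  ∃ f ∈ Fc, ∃ m, cs.IsModelWall m ∧ M = f '' m

/-- A half-apartment: the image of a half-apartment of the model space under a chart. -/
def IsHalfApartment (Fc : Set (ModelSpace n → X)) (H : Set X) : Prop :=
  ∃ f ∈ Fc, ∃ m h, cs.IsModelHalf m h ∧ H = f '' h

/-- An ℝ-building of type `(W̄,S)` with set of points `Λ` inside the ambient metric
space `X` (taking `Λ` a subset of an ambient metric space makes it possible to speak of
one ℝ-building being contained in another): a set of isometric charts from the model
space satisfying the axioms (A1)–(A5). -/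
structure RBuilding (cs : SphericalCoxeterSystem n) (X : Type*) [MetricSpace X]
    (Λ : Set X) : Type _ where
  charts : Set (ModelSpace n → X)
  isom : ∀ f ∈ charts, Isometry f
  into : ∀ f ∈ charts, range f ⊆ Λ
  A1 : ∀ f ∈ charts, ∀ w ∈ cs.W, (f ∘ ⇑w) ∈ charts
  A2 : ∀ f ∈ charts, ∀ g ∈ charts,
        IsClosed {x | f x ∈ range g} ∧ Convex ℝ {x | f x ∈ range g} ∧
        ∃ w ∈ cs.W, ∀ x, f x ∈ range g → f x = g (w x)
  A3 : ∀ p ∈ Λ, ∀ q ∈ Λ, ∃ f ∈ charts, p ∈ range f ∧ q ∈ range f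
  A4 : ∀ S₁ S₂, IsSector cs charts S₁ → IsSector cs charts S₂ →
        ∃ T₁ T₂ f, f ∈ charts ∧ IsSector cs charts T₁ ∧ IsSector cs charts T₂ ∧
          T₁ ⊆ S₁ ∧ T₂ ⊆ S₂ ∧ T₁ ⊆ range f ∧ T₂ ⊆ range f
  A5 : ∀ f₁ ∈ charts, ∀ f₂ ∈ charts, ∀ f₃ ∈ charts,
        IsHalfApartment cs charts (range f₁ ∩ range f₂) →
        IsHalfApartment cs charts (range f₂ ∩ range f₃) →
        IsHalfApartment cs charts (range f₁ ∩ range f₃) →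
        (range f₁ ∩ range f₂ ∩ range f₃).Nonempty

/-- The Weyl distance, inside the apartment given by the chart `f`, from the sector `S`
to the sector `S'` (both contained in that apartment): the element `w ∈ W̄` mapping the
sector of the model space based at the origin parallel to `f⁻¹(S)` to the one parallel
to `f⁻¹(S')`. -/
def WeylDistIn (f : ModelSpace n → X) (S S' : Set X)
    (w : ModelSpace n ≃ᵢ ModelSpace n) : Prop :=
  w ∈ cs.Wbar ∧ ∃ s s', cs.IsModelSector 0 s ∧ cs.IsModelSector 0 s' ∧
    Par (f '' s) S ∧ Par (f '' s') S' ∧ ⇑w '' s = s'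

/-- `w` is the Weyl distance from the germ at `α` of the sector `S` to the germ at `α`
of the sector `S'` (both based at `α`): computed via sectors based at `α` with the same
germs lying in a common apartment. -/
def GermWeylDist (Fc : Set (ModelSpace n → X)) (α : X) (S S' : Set X)
    (w : ModelSpace n ≃ᵢ ModelSpace n) : Prop :=
  ∃ f ∈ Fc, ∃ T T', IsSectorAt cs Fc α T ∧ IsSectorAt cs Fc α T' ∧
    T ⊆ range f ∧ T' ⊆ range f ∧ LocCoin α S T ∧ LocCoin α S' T' ∧
    WeylDistIn cs f T T' w

/-- `w` is the Weyl distance between the chambers at infinity represented by the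
sectors `S` and `S'`: computed via parallel sectors lying in a common apartment. -/
def ChamberWeylDist (Fc : Set (ModelSpace n → X)) (S S' : Set X)
    (w : ModelSpace n ≃ᵢ ModelSpace n) : Prop :=
  ∃ f ∈ Fc, ∃ T T', IsSector cs Fc T ∧ IsSector cs Fc T' ∧
    T ⊆ range f ∧ T' ⊆ range f ∧ Par T S ∧ Par T' S' ∧ WeylDistIn cs f T T' w

/-- The germs at `α` of two sectors based at `α` are opposite if their Weyl distance is
the longest element of `W̄`. -/
def OppositeGerms (Fc : Set (ModelSpace n → X)) (α : X) (S S' : Set X) : Prop :=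
  ∃ w, GermWeylDist cs Fc α S S' w ∧ cs.IsLongest w

/-- Two chambers at infinity (represented by the sectors `C`, `D`) are adjacent if they
are distinct and their Weyl distance lies in `S`. -/
def AdjacentChambers (Fc : Set (ModelSpace n → X)) (C D : Set X) : Prop :=
  ¬ Par C D ∧ ∃ s ∈ cs.S, ChamberWeylDist cs Fc C D s

/-- Two sector-panels are asymptotic if they contain a common subset which is itself a
sector-panel. -/
def Asymptotic (Fc : Set (ModelSpace n → X)) (P P' : Set X) : Prop :=
  ∃ Q, IsSectorPanel cs Fc Q ∧ Q ⊆ P ∧ Q ⊆ P'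

/-- An automorphism of an ℝ-building: an isometry `g` of `Λ` with `g ∘ f` a chart for
every chart `f`. -/
def RBuilding.IsAuto {Λ : Set X} (B : RBuilding cs X Λ) (g : ↥Λ ≃ᵢ ↥Λ) : Prop :=
  ∀ f (hf : f ∈ B.charts),
    (fun a : ModelSpace n =>
      ((g ⟨f a, B.into f hf (mem_range_self a)⟩ : ↥Λ) : X)) ∈ B.charts

end Building

section CAT0

/-- `G` is a geodesic segment from `x` to `y`: an isometric image of a closed real
interval with endpoints `x` and `y`. -/
def IsGeodesicSegment {Y : Type*} [MetricSpace Y] (x y : Y) (G : Set Y) : Prop :=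
  ∃ (a b : ℝ) (γ : ℝ → Y), a ≤ b ∧ γ a = x ∧ γ b = y ∧
    (∀ s ∈ Set.Icc a b, ∀ t ∈ Set.Icc a b, dist (γ s) (γ t) = |s - t|) ∧
    G = γ '' Set.Icc a b

/-- A CAT(0) space: a geodesic metric space in which every geodesic triangle satisfies
the CAT(0) comparison inequality with respect to comparison triangles in the Euclidean
plane. -/
def IsCAT0Space (Y : Type*) [MetricSpace Y] : Prop :=
  (∀ x y : Y, ∃ G, IsGeodesicSegment x y G) ∧
  ∀ (x y z : Y) (G : Set Y), IsGeodesicSegment x y G → ∀ a ∈ G,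
    ∀ x' y' z' : EuclideanSpace ℝ (Fin 2),
      dist x' y' = dist x y → dist y' z' = dist y z → dist x' z' = dist x z →
      ∀ a' ∈ segment ℝ x' y', dist x' a' = dist x a → dist z a ≤ dist z' a'

end CAT0

namespace SphericalCoxeterSystem

variable {n : ℕ}

/-- The orthogonal reflection along the vector `a`. -/
def reflAlong (a : ModelSpace n) : ModelSpace n ≃ₗᵢ[ℝ] ModelSpace n :=
  (ℝ ∙ a)ᗮ.reflection

theorem reflAlong_apply {a : ModelSpace n} (ha : ‖a‖ = 1) (x : ModelSpace n) :
    reflAlong a x = x - (2 * inner ℝ a x) • a := by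
  rw [reflAlong, Submodule.reflection_orthogonal_apply, Submodule.reflection_singleton_apply, ha]
  simp only [RCLike.ofReal_real_eq_id, id_eq, one_pow, div_one]
  rw [two_smul, mul_smul, two_smul]
  abel

theorem reflAlong_reflAlong (a x : ModelSpace n) : reflAlong a (reflAlong a x) = x :=
  Submodule.reflection_reflection _ x

theorem inner_reflAlong {a : ModelSpace n} (ha : ‖a‖ = 1) (x : ModelSpace n) :
    inner ℝ a (reflAlong a x) = -inner ℝ a x := by
  rw [reflAlong_apply ha, inner_sub_right, inner_smul_right, real_inner_self_eq_norm_sq, ha]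
  ring

theorem reflAlong_eq_self {a x : ModelSpace n} (ha : ‖a‖ = 1) (hx : inner ℝ a x = 0) :
    reflAlong a x = x := by
  rw [reflAlong_apply ha, hx]; simp

/-- A linear isometry fixing a hyperplane pointwise is the identity or a reflection. -/
theorem eq_one_or_eq_reflAlong {a : ModelSpace n} (ha : ‖a‖ = 1)
    (e : ModelSpace n ≃ₗᵢ[ℝ] ModelSpace n) (h : ∀ x, inner ℝ a x = 0 → e x = x) :
    (∀ x, e x = x) ∨ ∀ x, e x = reflAlong a x := by
  have haa : inner ℝ a a = (1 : ℝ) := by rw [real_inner_self_eq_norm_sq, ha]; norm_num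
  have hperp : ∀ x, inner ℝ a x = 0 → inner ℝ x (e a) = (0 : ℝ) := by
    intro x hx
    have := e.inner_map_map x a
    rw [h x hx, real_inner_comm] at this
    rw [real_inner_comm, this, real_inner_comm, hx]
  have hd := hperp (e a - (inner ℝ a (e a) : ℝ) • a) (by
    rw [inner_sub_right, inner_smul_right, haa]; ring)
  rw [inner_sub_left, inner_smul_left, real_inner_self_eq_norm_sq, e.norm_map, ha] at hd
  simp only [conj_trivial] at hd
  set c : ℝ := inner ℝ a (e a) with hc
  have hea : e a = c • a := by
    have : ‖e a - c • a‖ ^ 2 = 0 := by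
      rw [norm_sub_sq_real, inner_smul_right, norm_smul, e.norm_map, ha, real_inner_comm, ← hc,
        mul_one, Real.norm_eq_abs, sq_abs]
      nlinarith
    rw [← sub_eq_zero, ← norm_eq_zero]
    exact pow_eq_zero_iff (two_ne_zero) |>.1 this
  have hdec : ∀ x : ModelSpace n, e x = x + ((c - 1) * inner ℝ a x) • a := by
    intro x
    have h1 := h (x - (inner ℝ a x : ℝ) • a) (by
      rw [inner_sub_right, inner_smul_right, haa]; ring)
    rw [map_sub, map_smul, hea] at h1
    rw [sub_eq_iff_eq_add] at h1
    rw [h1]; module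
  have hc2 : (c - 1) * (c + 1) = 0 := by nlinarith
  rcases mul_eq_zero.1 hc2 with h1 | h1
  · left; intro x; rw [hdec, h1]; simp
  · right; intro x; rw [hdec, reflAlong_apply ha, show c = -1 by linarith]; module

variable (cs : SphericalCoxeterSystem n)

/-- The spherical reflection group as a group of linear isometries. -/
def Lin : Subgroup (ModelSpace n ≃ₗᵢ[ℝ] ModelSpace n) where
  carrier := {L | L.toIsometryEquiv ∈ cs.Wbar}
  mul_mem' {a b} ha hb := by
    have : (a * b).toIsometryEquiv = a.toIsometryEquiv * b.toIsometryEquiv := by ext; rfl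
    rw [mem_ofPred_eq, this]; exact mul_mem ha hb
  one_mem' := by
    have : (1 : ModelSpace n ≃ₗᵢ[ℝ] ModelSpace n).toIsometryEquiv = 1 := by ext; rfl
    rw [mem_ofPred_eq, this]; exact one_mem _
  inv_mem' {a} ha := by
    have : (a⁻¹).toIsometryEquiv = a.toIsometryEquiv⁻¹ := by ext; rfl
    rw [mem_ofPred_eq, this]; exact inv_mem ha

/-- Unit normal vectors of the walls through the origin. -/
def Roots : Set (ModelSpace n) :=
  {a | ∃ L ∈ cs.Lin, ∃ b, ‖b‖ = 1 ∧ (reflAlong b).toIsometryEquiv ∈ cs.S ∧ a = L b}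

variable {cs}

theorem norm_of_mem_Roots {a : ModelSpace n} (ha : a ∈ cs.Roots) : ‖a‖ = 1 := by
  obtain ⟨L, -, b, hb, -, rfl⟩ := ha
  rw [L.norm_map, hb]

theorem Roots_map {L : ModelSpace n ≃ₗᵢ[ℝ] ModelSpace n} (hL : L ∈ cs.Lin) {a : ModelSpace n}
    (ha : a ∈ cs.Roots) : L a ∈ cs.Roots := by
  obtain ⟨M, hM, b, hb, hs, rfl⟩ := ha
  exact ⟨L * M, mul_mem hL hM, b, hb, hs, rfl⟩

theorem reflAlong_map (L : ModelSpace n ≃ₗᵢ[ℝ] ModelSpace n) {b : ModelSpace n} (hb : ‖b‖ = 1) :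
    reflAlong (L b) = L * reflAlong b * L⁻¹ := by
  ext1 x
  have hx : x = L (L⁻¹ x) := (L.apply_symm_apply x).symm
  simp only [LinearIsometryEquiv.coe_mul, Function.comp_apply]
  rw [reflAlong_apply (by rw [L.norm_map, hb]), reflAlong_apply hb, map_sub, map_smul, ← hx]
  congr 3
  conv_lhs => rw [hx, L.inner_map_map]

theorem reflAlong_mem_Lin {a : ModelSpace n} (ha : a ∈ cs.Roots) : reflAlong a ∈ cs.Lin := by
  obtain ⟨L, hL, b, hb, hs, rfl⟩ := ha
  rw [reflAlong_map L hb]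
  exact mul_mem (mul_mem hL (Subgroup.subset_closure hs)) (inv_mem hL)

theorem Roots_neg {a : ModelSpace n} (ha : a ∈ cs.Roots) : -a ∈ cs.Roots := by
  have h1 := Roots_map (reflAlong_mem_Lin ha) ha
  rwa [reflAlong_apply (norm_of_mem_Roots ha), real_inner_self_eq_norm_sq, norm_of_mem_Roots ha,
    show a - (2 * 1 ^ 2 : ℝ) • a = -a by module] at h1

theorem finite_Lin : (cs.Lin : Set (ModelSpace n ≃ₗᵢ[ℝ] ModelSpace n)).Finite := by
  have hW : (cs.Wbar : Set (ModelSpace n ≃ᵢ ModelSpace n)).Finite := cs.finiteW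
  refine (hW.preimage (f := LinearIsometryEquiv.toIsometryEquiv) ?_)
  intro a _ b _ h
  ext1 x
  exact DFunLike.congr_fun h x

theorem finite_Roots (cs : SphericalCoxeterSystem n) : cs.Roots.Finite := by
  have hsub : cs.Roots ⊆ ⋃ L ∈ (cs.Lin : Set (ModelSpace n ≃ₗᵢ[ℝ] ModelSpace n)),
      {a : ModelSpace n | ‖a‖ = 1 ∧ reflAlong a = L} := by
    intro a ha
    simp only [mem_iUnion]
    exact ⟨_, reflAlong_mem_Lin ha, norm_of_mem_Roots ha, rfl⟩
  refine (finite_Lin.biUnion fun L _ => ?_).subset hsub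
  rcases eq_empty_or_nonempty {a : ModelSpace n | ‖a‖ = 1 ∧ reflAlong a = L} with h | ⟨a, ha, haL⟩
  · rw [h]; exact finite_empty
  refine (toFinite {a, -a}).subset ?_
  rintro b ⟨hb, hbL⟩
  have h1 := inner_reflAlong ha b
  rw [haL, ← hbL, reflAlong_apply hb, real_inner_self_eq_norm_sq, hb] at h1
  have h2 : (reflAlong a) b = -b := by
    rw [haL, ← hbL, reflAlong_apply hb, real_inner_self_eq_norm_sq, hb]; module
  rw [reflAlong_apply ha] at h2
  have h3 : b = (inner ℝ a b : ℝ) • a := by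
    have h4 : (2 : ℝ) • b = (2 : ℝ) • ((inner ℝ a b : ℝ) • a) := by
      calc (2 : ℝ) • b = b - -b := by module
        _ = (2 : ℝ) • ((inner ℝ a b : ℝ) • a) := by rw [← h2]; module
    exact smul_right_injective _ (two_ne_zero) h4
  have h5 : |(inner ℝ a b : ℝ)| = 1 := by
    have := congrArg norm h3
    rw [norm_smul, hb, ha, mul_one] at this
    exact this.symm
  rcases (abs_eq (zero_le_one)).1 h5 with h | h <;> rw [h] at h3 <;> simp [h3]

/-- Every linear reflection is the orthogonal reflection along a unit vector. -/
theorem exists_reflAlong_of_isLinearReflection {s : ModelSpace n ≃ᵢ ModelSpace n}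
    (hs : IsLinearReflection s) :
    ∃ b : ModelSpace n, ‖b‖ = 1 ∧ (reflAlong b).toIsometryEquiv = s := by
  obtain ⟨-, hne, p, hp, hfix⟩ := hs
  have h0 : s 0 = 0 := by
    have : (0 : ModelSpace n) ∈ {x | s x = x} := by rw [hfix]; simp
    exact this
  let e := s.toRealLinearIsometryEquivOfMapZero h0
  have he : ∀ x, e x = s x := fun x => rfl
  let q := (InnerProductSpace.toDual ℝ (ModelSpace n)).symm (LinearMap.toContinuousLinearMap p)
  have hq : ∀ x, inner ℝ q x = p x := fun x => by
    rw [InnerProductSpace.toDual_symm_apply]; rfl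
  have hq0 : q ≠ 0 := by
    intro h
    apply hp
    ext1 x
    simp [← hq, h]
  have hqn : ‖q‖ ≠ 0 := norm_ne_zero_iff.2 hq0
  have hb : ‖(‖q‖⁻¹ • q)‖ = 1 := by rw [norm_smul, norm_inv, norm_norm, inv_mul_cancel₀ hqn]
  refine ⟨‖q‖⁻¹ • q, hb, ?_⟩
  have key := eq_one_or_eq_reflAlong hb e (by
    intro x hx
    rw [inner_smul_left, hq] at hx
    have : p x = 0 := by simpa [hqn] using hx
    have : x ∈ {x | s x = x} := by rw [hfix]; exact this
    exact this)
  rcases key with h | h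
  · exact absurd (by ext1 x; exact h x) hne
  · ext1 x; exact (h x).symm

/-- Elements of the affine group have a linear part in the spherical group. -/
theorem exists_lin_of_mem_W {w : ModelSpace n ≃ᵢ ModelSpace n} (hw : w ∈ cs.W) :
    ∃ L ∈ cs.Lin, ∃ v, ∀ x, w x = L x + v := by
  induction hw using Subgroup.closure_induction with
  | mem s hs =>
    rcases hs with hs | ⟨v, hv⟩
    · obtain ⟨b, hb, rfl⟩ := exists_reflAlong_of_isLinearReflection (cs.refl s hs)
      exact ⟨reflAlong b, Subgroup.subset_closure hs, 0, fun x => by simp⟩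
    · exact ⟨1, one_mem _, v, hv⟩
  | one => exact ⟨1, one_mem _, 0, fun x => by simp⟩
  | mul a b _ _ ha hb =>
    obtain ⟨L, hL, v, h1⟩ := ha
    obtain ⟨M, hM, u, h2⟩ := hb
    refine ⟨L * M, mul_mem hL hM, L u + v, fun x => ?_⟩
    rw [IsometryEquiv.mul_apply, h2, h1, map_add, LinearIsometryEquiv.coe_mul, Function.comp_apply,
      add_assoc]
  | inv a _ ha =>
    obtain ⟨L, hL, v, h1⟩ := ha
    refine ⟨L⁻¹, inv_mem hL, -(L⁻¹ v), fun x => ?_⟩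
    apply a.injective
    rw [IsometryEquiv.apply_inv_self, h1, ← sub_eq_add_neg, ← map_sub]
    have : L (L⁻¹ (x - v)) = x - v := L.apply_symm_apply _
    rw [this, sub_add_cancel]

theorem exists_mem_W {L : ModelSpace n ≃ₗᵢ[ℝ] ModelSpace n} (hL : L ∈ cs.Lin)
    (v : ModelSpace n) : ∃ w ∈ cs.W, ∀ x, w x = L x + v := by
  refine ⟨IsometryEquiv.addRight v * L.toIsometryEquiv, mul_mem ?_ ?_, fun x => rfl⟩
  · exact Subgroup.subset_closure (Or.inr ⟨v, fun x => rfl⟩)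
  · exact Subgroup.closure_mono (subset_union_left) hL

theorem IsAffineReflection.exists_root {r : ModelSpace n ≃ᵢ ModelSpace n}
    (hr : cs.IsAffineReflection r) :
    ∃ a ∈ cs.Roots, ∃ c : ℝ, ∀ x, r x = x - (2 * (inner ℝ a x - c)) • a := by
  obtain ⟨s, hs, w, hw, rfl⟩ := hr
  obtain ⟨b, hb, rfl⟩ := exists_reflAlong_of_isLinearReflection (cs.refl s hs)
  obtain ⟨L, hL, v, h⟩ := exists_lin_of_mem_W hw
  refine ⟨L b, ⟨L, hL, b, hb, hs, rfl⟩, inner ℝ (L b) v, fun x => ?_⟩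
  set y := w⁻¹ x with hy
  have hx : x = L y + v := by rw [← h, hy, IsometryEquiv.apply_inv_self]
  rw [IsometryEquiv.mul_apply, IsometryEquiv.mul_apply, ← hy, h]
  rw [LinearIsometryEquiv.coe_toIsometryEquiv, reflAlong_apply hb, map_sub, map_smul, hx,
    inner_add_right, L.inner_map_map]
  module

theorem exists_isAffineReflection {a : ModelSpace n} (ha : a ∈ cs.Roots) (c : ℝ) :
    ∃ r, cs.IsAffineReflection r ∧ ∀ x, r x = x - (2 * (inner ℝ a x - c)) • a := by
  have hn := norm_of_mem_Roots ha
  obtain ⟨L, hL, b, hb, hs, rfl⟩ := ha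
  obtain ⟨w, hw, h⟩ := exists_mem_W hL (c • L b)
  refine ⟨_, ⟨_, hs, w, hw, rfl⟩, fun x => ?_⟩
  set y := w⁻¹ x with hy
  have hx : x = L y + c • L b := by rw [← h, hy, IsometryEquiv.apply_inv_self]
  rw [IsometryEquiv.mul_apply, IsometryEquiv.mul_apply, ← hy, h]
  rw [LinearIsometryEquiv.coe_toIsometryEquiv, reflAlong_apply hb, map_sub, map_smul, hx,
    inner_add_right, L.inner_map_map, inner_smul_right, real_inner_self_eq_norm_sq, hn]
  module

theorem reflection_fixed_iff {a : ModelSpace n} (ha : a ∈ cs.Roots) {c : ℝ} {x : ModelSpace n} :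
    x - (2 * (inner ℝ a x - c)) • a = x ↔ inner ℝ a x = c := by
  have hne : a ≠ 0 := by
    intro h; have := norm_of_mem_Roots ha; simp [h] at this
  rw [sub_eq_self, smul_eq_zero]
  constructor
  · rintro (h | h)
    · linarith
    · exact absurd h hne
  · intro h; left; rw [h]; ring

theorem isModelWall_iff {M : Set (ModelSpace n)} :
    cs.IsModelWall M ↔ ∃ a ∈ cs.Roots, ∃ c : ℝ, M = {x | inner ℝ a x = c} := by
  constructor
  · rintro ⟨r, hr, rfl⟩
    obtain ⟨a, ha, c, h⟩ := hr.exists_root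
    refine ⟨a, ha, c, ?_⟩
    ext x
    rw [mem_ofPred_eq, mem_ofPred_eq, h, reflection_fixed_iff ha]
  · rintro ⟨a, ha, c, rfl⟩
    obtain ⟨r, hr, h⟩ := exists_isAffineReflection ha c
    refine ⟨r, hr, ?_⟩
    ext x
    rw [mem_ofPred_eq, mem_ofPred_eq, h, reflection_fixed_iff ha]

theorem isModelHalf_halfSpace {a : ModelSpace n} (ha : a ∈ cs.Roots) (c : ℝ) :
    cs.IsModelHalf {x | inner ℝ a x = c} {x | c ≤ inner ℝ a x} := by
  have hn := norm_of_mem_Roots ha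
  obtain ⟨r, hr, h⟩ := exists_isAffineReflection ha c
  have hir : ∀ x, inner ℝ a (r x) = 2 * c - inner ℝ a x := by
    intro x
    rw [h, inner_sub_right, inner_smul_right, real_inner_self_eq_norm_sq, hn]; ring
  have hrr : ∀ x, r (r x) = x := by
    intro x
    rw [h (r x), hir, h x]; module
  have himg : r '' {x | c ≤ inner ℝ a x} = {x | inner ℝ a x ≤ c} := by
    ext x
    constructor
    · rintro ⟨y, hy, rfl⟩
      rw [mem_ofPred_eq] at hy ⊢
      rw [hir]; linarith
    · intro hx
      refine ⟨r x, ?_, hrr x⟩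
      rw [mem_ofPred_eq] at hx ⊢
      rw [hir]; linarith
  refine ⟨r, hr, ?_, ?_, ?_, ?_, ?_⟩
  · ext x; rw [mem_ofPred_eq, mem_ofPred_eq, h, reflection_fixed_iff ha]
  · exact isClosed_le continuous_const (by fun_prop)
  · exact convex_halfSpace_ge (innerₗ (ModelSpace n) a).isLinear c
  · rw [himg]; ext x; simp [le_total]
  · rw [himg]; ext x; simp only [mem_inter_iff, mem_ofPred_eq]
    exact ⟨fun h => le_antisymm h.2 h.1, fun h => ⟨h.ge, h.le⟩⟩

/-- A half-apartment lies on one side of its wall. -/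
theorem IsModelHalf.one_sided {a : ModelSpace n} (ha : a ∈ cs.Roots) {c : ℝ}
    {H : Set (ModelSpace n)} (hH : cs.IsModelHalf {x | inner ℝ a x = c} H)
    {y y' : ModelSpace n} (hy : y ∈ H) (hy' : y' ∈ H) (h1 : c < inner ℝ a y) :
    c ≤ inner ℝ a y' := by
  by_contra! h2
  obtain ⟨r, hr, hM, -, hconv, hun, hmeet⟩ := hH
  have hn := norm_of_mem_Roots ha
  have hMH : {x | inner ℝ a x = c} ⊆ H := by rw [← hmeet]; exact inter_subset_left
  -- points of small height on the side of a given point of `H` lie in `H`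
  have key : ∀ y ∈ H, ∀ z : ModelSpace n, ∀ t : ℝ, 0 < t → t < 1 →
      inner ℝ a z - c = t * (inner ℝ a y - c) → z ∈ H := by
    intro y hy z t ht0 ht1 hz
    have hm : (1 - t)⁻¹ • (z - t • y) ∈ H := by
      apply hMH
      rw [mem_ofPred_eq, inner_smul_right, inner_sub_right, inner_smul_right]
      have : (1 - t) ≠ 0 := by linarith
      field_simp
      linarith
    have := hconv hy hm ht0.le (by linarith : 0 ≤ 1 - t) (by ring)
    rwa [smul_inv_smul₀ (by linarith : (1 - t) ≠ 0), add_sub_cancel] at this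
  obtain ⟨b, hb, c', hrf⟩ := hr.exists_root
  set θ := inner ℝ a y - c with hθ
  set η := c - inner ℝ a y' with hη
  have hθ0 : 0 < θ := by linarith
  have hη0 : 0 < η := by linarith
  set ε := min θ η / 2 with hε
  have hε0 : 0 < ε := by positivity
  have hεθ : ε < θ := by have := min_le_left θ η; linarith
  have hεη : ε < η := by have := min_le_right θ η; linarith
  -- the fixed points of `r`
  have hfix : ∀ x, inner ℝ a x = c → r x = x := by
    intro x hx
    have : x ∈ {x | r x = x} := by rw [← hM]; exact hx
    exact this
  have hfix' : ∀ x, r x = x → inner ℝ a x = c := by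
    intro x hx
    have : x ∈ {x | inner ℝ a x = c} := by rw [hM]; exact hx
    exact this
  set x₀ : ModelSpace n := c • a with hx₀
  have haa : inner ℝ a a = (1 : ℝ) := by rw [real_inner_self_eq_norm_sq, hn]; norm_num
  set z : ModelSpace n := x₀ + ε • a with hz
  have hiz : inner ℝ a z = c + ε := by
    rw [hz, hx₀, inner_add_right, inner_smul_right, inner_smul_right, haa]; ring
  have hbb : inner ℝ b b = (1 : ℝ) := by
    rw [real_inner_self_eq_norm_sq, norm_of_mem_Roots hb]; norm_num
  have hmid : inner ℝ a (r z) = c - ε := by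
    have hm : r ((1 / 2 : ℝ) • (z + r z)) = (1 / 2 : ℝ) • (z + r z) := by
      rw [hrf ((1 / 2 : ℝ) • (z + r z)), reflection_fixed_iff hb, inner_smul_right, inner_add_right,
        hrf z, inner_sub_right, inner_smul_right, hbb]
      ring
    have := hfix' _ hm
    rw [inner_smul_right, inner_add_right, hiz] at this
    linarith
  have hrr : r (r z) = z := by
    rw [hrf (r z), hrf z, inner_sub_right, inner_smul_right, hbb]
    module
  have hzH : z ∈ H := key y hy z (ε / θ) (by positivity) ((div_lt_one hθ0).2 hεθ) (by
    rw [hiz, ← hθ]; field_simp; ring)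
  have hrzH : r z ∈ H := key y' hy' (r z) (ε / η) (by positivity) ((div_lt_one hη0).2 hεη) (by
    rw [hmid, show inner ℝ a y' - c = -η by rw [hη]; ring]; field_simp; ring)
  have : z ∈ {x | inner ℝ a x = c} := by
    rw [← hmeet]; exact ⟨hzH, r z, hrzH, hrr⟩
  rw [mem_ofPred_eq, hiz] at this
  linarith

end SphericalCoxeterSystem

namespace SphericalCoxeterSystem

variable {n : ℕ} (cs : SphericalCoxeterSystem n)

/-- A vector is regular if it lies on no wall through the origin. -/
def Reg (u : ModelSpace n) : Prop := ∀ a ∈ cs.Roots, (inner ℝ a u : ℝ) ≠ 0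

/-- The closed chamber of the regular vector `u`. -/
def Ch (u : ModelSpace n) : Set (ModelSpace n) :=
  {v | ∀ a ∈ cs.Roots, (0 : ℝ) < inner ℝ a u → (0 : ℝ) ≤ inner ℝ a v}

variable {cs}

theorem self_mem_Ch (u : ModelSpace n) : u ∈ cs.Ch u := fun _ _ h => h.le

theorem zero_mem_Ch (u : ModelSpace n) : 0 ∈ cs.Ch u := fun a _ _ => by simp

theorem add_mem_Ch {u v w : ModelSpace n} (hv : v ∈ cs.Ch u) (hw : w ∈ cs.Ch u) :
    v + w ∈ cs.Ch u := fun a ha h => by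
  rw [inner_add_right]; exact add_nonneg (hv a ha h) (hw a ha h)

theorem smul_mem_Ch {u v : ModelSpace n} {t : ℝ} (ht : 0 ≤ t) (hv : v ∈ cs.Ch u) :
    t • v ∈ cs.Ch u := fun a ha h => by
  rw [inner_smul_right]; exact mul_nonneg ht (hv a ha h)

theorem smul_mem_Ch_iff {u v : ModelSpace n} {t : ℝ} (ht : 0 < t) :
    t • v ∈ cs.Ch u ↔ v ∈ cs.Ch u := by
  refine ⟨fun h => ?_, smul_mem_Ch ht.le⟩
  have := smul_mem_Ch (inv_nonneg.2 ht.le) h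
  rwa [inv_smul_smul₀ ht.ne'] at this

theorem Reg.neg {u : ModelSpace n} (hu : cs.Reg u) : cs.Reg (-u) := fun a ha h => by
  rw [inner_neg_right, neg_eq_zero] at h; exact hu a ha h

theorem mem_Ch_neg {u v : ModelSpace n} : v ∈ cs.Ch (-u) ↔ -v ∈ cs.Ch u := by
  constructor
  · intro h a ha hp
    have := h _ (Roots_neg ha) (by rwa [inner_neg_neg])
    rwa [inner_neg_left, ← inner_neg_right] at this
  · intro h a ha hp
    have := h _ (Roots_neg ha) (by rwa [inner_neg_left, ← inner_neg_right])
    rwa [inner_neg_neg] at this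

theorem inner_map_inv (L : ModelSpace n ≃ₗᵢ[ℝ] ModelSpace n) (a v : ModelSpace n) :
    inner ℝ a (L v) = inner ℝ (L⁻¹ a) v := by
  conv_lhs => rw [← show L (L⁻¹ a) = a from L.apply_symm_apply a]
  exact L.inner_map_map _ _

theorem Reg.map {u : ModelSpace n} (hu : cs.Reg u) {L : ModelSpace n ≃ₗᵢ[ℝ] ModelSpace n}
    (hL : L ∈ cs.Lin) : cs.Reg (L u) := fun a ha h => by
  rw [inner_map_inv] at h; exact hu _ (Roots_map (inv_mem hL) ha) h

theorem map_mem_Ch {u v : ModelSpace n} {L : ModelSpace n ≃ₗᵢ[ℝ] ModelSpace n}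
    (hL : L ∈ cs.Lin) (hv : v ∈ cs.Ch u) : L v ∈ cs.Ch (L u) := fun a ha h => by
  rw [inner_map_inv] at h ⊢; exact hv _ (Roots_map (inv_mem hL) ha) h

theorem map_mem_Ch_iff {u v : ModelSpace n} {L : ModelSpace n ≃ₗᵢ[ℝ] ModelSpace n}
    (hL : L ∈ cs.Lin) : L v ∈ cs.Ch (L u) ↔ v ∈ cs.Ch u := by
  refine ⟨fun h => ?_, map_mem_Ch hL⟩
  have := map_mem_Ch (inv_mem hL) h
  rwa [show L⁻¹ (L v) = v from L.symm_apply_apply v,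
    show L⁻¹ (L u) = u from L.symm_apply_apply u] at this

theorem mem_Ch_map_iff {u v : ModelSpace n} {L : ModelSpace n ≃ₗᵢ[ℝ] ModelSpace n}
    (hL : L ∈ cs.Lin) : v ∈ cs.Ch (L u) ↔ L⁻¹ v ∈ cs.Ch u := by
  rw [← map_mem_Ch_iff hL (v := L⁻¹ v), show L (L⁻¹ v) = v from L.apply_symm_apply v]

theorem Ch_eq_of_pos_iff {u u' : ModelSpace n}
    (h : ∀ a ∈ cs.Roots, (0 : ℝ) < inner ℝ a u ↔ (0 : ℝ) < inner ℝ a u') :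
    cs.Ch u = cs.Ch u' := by
  ext v
  exact forall₂_congr fun a ha => by rw [h a ha]

theorem Reg.pos_iff_of_mem {u u' : ModelSpace n} (hu : cs.Reg u) (hu' : cs.Reg u')
    (h : u' ∈ cs.Ch u) (a : ModelSpace n) (ha : a ∈ cs.Roots) :
    (0 : ℝ) < inner ℝ a u ↔ (0 : ℝ) < inner ℝ a u' := by
  constructor
  · intro hp; exact lt_of_le_of_ne (h a ha hp) (hu' a ha).symm
  · intro hp
    by_contra hn
    have h1 := lt_of_le_of_ne (not_lt.1 hn) (hu a ha)
    have h2 := h _ (Roots_neg ha) (by rw [inner_neg_left]; linarith)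
    rw [inner_neg_left] at h2
    linarith

theorem Reg.Ch_eq_of_mem {u u' : ModelSpace n} (hu : cs.Reg u) (hu' : cs.Reg u')
    (h : u' ∈ cs.Ch u) : cs.Ch u = cs.Ch u' :=
  Ch_eq_of_pos_iff (hu.pos_iff_of_mem hu' h)

theorem isClosed_Ch (u : ModelSpace n) : IsClosed (cs.Ch u) := by
  have : cs.Ch u = ⋂ a ∈ cs.Roots, ⋂ _ : (0 : ℝ) < inner ℝ a u, {v | (0 : ℝ) ≤ inner ℝ a v} := by
    ext v; simp [Ch]
  rw [this]
  exact isClosed_biInter fun a _ => isClosed_iInter fun _ =>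
    isClosed_le continuous_const (by fun_prop)

theorem exists_le_abs_inner (cs : SphericalCoxeterSystem n) (p : ModelSpace n) :
    ∃ m : ℝ, 0 < m ∧ ∀ b ∈ cs.Roots, (inner ℝ b p : ℝ) ≠ 0 → m ≤ |(inner ℝ b p : ℝ)| := by
  have h : ∀ᶠ m : ℝ in nhdsWithin 0 (Ioi 0),
      ∀ b ∈ cs.Roots, (inner ℝ b p : ℝ) ≠ 0 → m ≤ |(inner ℝ b p : ℝ)| := by
    refine (Filter.eventually_all_finite (finite_Roots cs)).2 fun b _ => ?_
    by_cases h0 : (inner ℝ b p : ℝ) = 0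
    · exact Filter.Eventually.of_forall fun m h => absurd h0 h
    · have : Iic |(inner ℝ b p : ℝ)| ∈ nhdsWithin (0 : ℝ) (Ioi 0) :=
        mem_nhdsWithin_of_mem_nhds (Iic_mem_nhds (abs_pos.2 h0))
      filter_upwards [this] with m hm _ using hm
  obtain ⟨m, h1, h2⟩ := (h.and self_mem_nhdsWithin).exists
  exact ⟨m, h2, h1⟩

theorem abs_inner_root_le {b : ModelSpace n} (hb : b ∈ cs.Roots) (w : ModelSpace n) :
    |(inner ℝ b w : ℝ)| ≤ ‖w‖ := by
  have := abs_real_inner_le_norm b w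
  rwa [norm_of_mem_Roots hb, one_mul] at this

/-- Deep translates absorb bounded perturbations. -/
theorem exists_smul_add_mem_Ch (cs : SphericalCoxeterSystem n) (u : ModelSpace n) :
    ∃ C : ℝ, 0 < C ∧ ∀ (w : ModelSpace n) (t : ℝ), C * ‖w‖ ≤ t → t • u + w ∈ cs.Ch u := by
  obtain ⟨m, hm, h⟩ := exists_le_abs_inner cs u
  refine ⟨m⁻¹, inv_pos.2 hm, fun w t ht b hb hp => ?_⟩
  have h1 := h b hb hp.ne'
  rw [abs_of_pos hp] at h1
  have h2 := neg_le_of_abs_le (abs_inner_root_le hb w)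
  rw [inner_add_right, inner_smul_right]
  rw [inv_mul_le_iff₀ hm] at ht
  have ht0 : 0 ≤ t := by
    by_contra hn
    have := norm_nonneg w
    nlinarith
  nlinarith

theorem eq_id_of_eqOn_Ch {u : ModelSpace n} {ε : ℝ} (hε : 0 < ε)
    (L : ModelSpace n ≃ₗᵢ[ℝ] ModelSpace n) (h : ∀ v ∈ cs.Ch u, ‖v‖ < ε → L v = v)
    (x : ModelSpace n) : L x = x := by
  have h' : ∀ v ∈ cs.Ch u, L v = v := by
    intro v hv
    set s : ℝ := ε / (‖v‖ + 1) with hs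
    have hv0 := norm_nonneg v
    have hs0 : 0 < s := by positivity
    have := h (s • v) (smul_mem_Ch hs0.le hv) (by
      rw [norm_smul, Real.norm_of_nonneg hs0.le, hs, div_mul_eq_mul_div,
        div_lt_iff₀ (by positivity)]
      nlinarith)
    rw [map_smul] at this
    exact smul_right_injective _ hs0.ne' this
  obtain ⟨C, hC, hCh⟩ := exists_smul_add_mem_Ch cs u
  have h1 := h' _ (hCh x (C * ‖x‖) le_rfl)
  have h2 := h' _ (hCh 0 (C * ‖x‖) (by rw [norm_zero, mul_zero]; positivity))
  rw [add_zero] at h2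
  rw [map_add, h2] at h1
  exact add_left_cancel h1

theorem exists_reg (cs : SphericalCoxeterSystem n) : ∃ g, cs.Reg g := by
  have := (finite_Roots cs).to_subtype
  obtain ⟨f, hf⟩ := Module.exists_dual_forall_apply_ne_zero (K := ℝ)
    (v := fun a : cs.Roots => (a : ModelSpace n)) (fun a h => by
      have := norm_of_mem_Roots a.2
      simp [h] at this)
  refine ⟨(InnerProductSpace.toDual ℝ (ModelSpace n)).symm (LinearMap.toContinuousLinearMap f),
    fun a ha h => hf ⟨a, ha⟩ ?_⟩
  rw [real_inner_comm, InnerProductSpace.toDual_symm_apply] at h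
  exact h

/-- Every vector is a limit of regular vectors of a chamber containing it. -/
theorem exists_reg_perturb (cs : SphericalCoxeterSystem n) (v : ModelSpace n) :
    ∃ u, cs.Reg u ∧ ∀ a ∈ cs.Roots, (0 : ℝ) < inner ℝ a v → (0 : ℝ) < inner ℝ a u := by
  obtain ⟨g, hg⟩ := exists_reg cs
  have h : ∀ᶠ s : ℝ in nhdsWithin 0 (Ioi 0), ∀ a ∈ cs.Roots, (inner ℝ a (v + s • g) : ℝ) ≠ 0 ∧
      ((0 : ℝ) < inner ℝ a v → (0 : ℝ) < inner ℝ a (v + s • g)) := by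
    refine (Filter.eventually_all_finite (finite_Roots cs)).2 fun a ha => ?_
    have hc : Filter.Tendsto (fun s : ℝ => (inner ℝ a (v + s • g) : ℝ)) (nhdsWithin 0 (Ioi 0))
        (nhds (inner ℝ a v)) := by
      have : Continuous (fun s : ℝ => (inner ℝ a (v + s • g) : ℝ)) := by fun_prop
      have := this.tendsto 0
      simp only [zero_smul, add_zero] at this
      exact this.mono_left nhdsWithin_le_nhds
    rcases lt_trichotomy (inner ℝ a v : ℝ) 0 with h0 | h0 | h0
    · filter_upwards [hc.eventually (Iio_mem_nhds h0)] with s hs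
      exact ⟨hs.ne, fun h => absurd h0 h.not_gt⟩
    · filter_upwards [self_mem_nhdsWithin] with s hs
      refine ⟨?_, fun h => absurd h0 h.ne'⟩
      rw [inner_add_right, inner_smul_right, h0, zero_add]
      exact mul_ne_zero (ne_of_gt hs) (hg a ha)
    · filter_upwards [hc.eventually (Ioi_mem_nhds h0)] with s hs
      exact ⟨ne_of_gt hs, fun _ => hs⟩
  obtain ⟨s, hs⟩ := h.exists
  exact ⟨v + s • g, fun a ha => (hs a ha).1, fun a ha => (hs a ha).2⟩

theorem exists_reg_mem_Ch (cs : SphericalCoxeterSystem n) (v : ModelSpace n) :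
    ∃ u, cs.Reg u ∧ v ∈ cs.Ch u := by
  obtain ⟨u, hu, h⟩ := exists_reg_perturb cs v
  refine ⟨u, hu, fun a ha hp => ?_⟩
  by_contra hn
  have h1 := h _ (Roots_neg ha) (by rw [inner_neg_left]; linarith)
  rw [inner_neg_left] at h1
  linarith

theorem isModelSectorFace_Ch (x u : ModelSpace n) (hu : cs.Reg u) :
    cs.IsModelSectorFace x {y | y - x ∈ cs.Ch u} := by
  refine ⟨⟨x, by rw [mem_ofPred_eq, sub_self]; exact zero_mem_Ch u⟩,
    fun M => {y | ∀ a ∈ cs.Roots, M = {z | (inner ℝ a z : ℝ) = inner ℝ a x} →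
      (0 : ℝ) < inner ℝ a u → (0 : ℝ) ≤ inner ℝ a (y - x)}, ?_, ?_⟩
  · intro M hM hx
    right
    obtain ⟨a, ha, c, rfl⟩ := isModelWall_iff.1 hM
    rw [mem_ofPred_eq] at hx
    subst hx
    wlog hpos : (0 : ℝ) < inner ℝ a u generalizing a
    · have h1 := this (-a) (Roots_neg ha) (by
        have : {z : ModelSpace n | (inner ℝ (-a) z : ℝ) = inner ℝ (-a) x} =
          {z | (inner ℝ a z : ℝ) = inner ℝ a x} := by ext z; simp [inner_neg_left]
        rw [this]; exact hM) (by
        rw [inner_neg_left]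
        have := hu a ha
        have := lt_of_le_of_ne (not_lt.1 hpos) this
        linarith)
      have : {z : ModelSpace n | (inner ℝ (-a) z : ℝ) = inner ℝ (-a) x} =
          {z | (inner ℝ a z : ℝ) = inner ℝ a x} := by ext z; simp [inner_neg_left]
      rwa [this] at h1
    have key : {y : ModelSpace n | ∀ b ∈ cs.Roots,
        {z : ModelSpace n | (inner ℝ a z : ℝ) = inner ℝ a x}
        = {z | (inner ℝ b z : ℝ) = inner ℝ b x} → (0 : ℝ) < inner ℝ b u →
        (0 : ℝ) ≤ inner ℝ b (y - x)} = {y | (inner ℝ a x : ℝ) ≤ inner ℝ a y} := by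
      ext y
      constructor
      · intro h
        have := h a ha rfl hpos
        rw [inner_sub_right] at this
        rw [mem_ofPred_eq]; linarith
      · intro h b hb heq hbu
        rw [mem_ofPred_eq] at h
        -- the two roots are proportional
        have hn := norm_of_mem_Roots ha
        have haa : inner ℝ a a = (1 : ℝ) := by rw [real_inner_self_eq_norm_sq, hn]; norm_num
        have hperp : ∀ w : ModelSpace n, (inner ℝ a w : ℝ) = 0 → (inner ℝ b w : ℝ) = 0 := by
          intro w hw
          have : x + w ∈ {z : ModelSpace n | (inner ℝ b z : ℝ) = inner ℝ b x} := by
            rw [← heq, mem_ofPred_eq, inner_add_right, hw, add_zero]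
          rw [mem_ofPred_eq, inner_add_right] at this
          linarith
        have hb' : ∀ w : ModelSpace n, (inner ℝ b w : ℝ) = inner ℝ b a * inner ℝ a w := by
          intro w
          have := hperp (w - (inner ℝ a w : ℝ) • a) (by
            rw [inner_sub_right, inner_smul_right, haa]; ring)
          rw [inner_sub_right, inner_smul_right] at this
          linarith
        rw [hb'] at hbu ⊢
        have : (0 : ℝ) < inner ℝ b a := pos_of_mul_pos_left hbu hpos.le
        rw [inner_sub_right]
        exact mul_nonneg this.le (by linarith)
    beta_reduce
    rw [key]
    exact isModelHalf_halfSpace ha _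
  · ext y
    simp only [mem_iInter, mem_ofPred_eq]
    constructor
    · intro h M _ a ha _ hp
      exact h a ha hp
    · intro h a ha hp
      exact h {z | (inner ℝ a z : ℝ) = inner ℝ a x} ⟨isModelWall_iff.2 ⟨a, ha, _, rfl⟩, rfl⟩
        a ha rfl hp

theorem IsModelSectorFace.exists_reg_subset {x : ModelSpace n} {F : Set (ModelSpace n)}
    (hF : cs.IsModelSectorFace x F) : ∃ u, cs.Reg u ∧ F ⊆ {y | y - x ∈ cs.Ch u} := by
  obtain ⟨-, σ, hσ, rfl⟩ := hF
  set F := ⋂ M ∈ {M | cs.IsModelWall M ∧ x ∈ M}, σ M with hF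
  have hside : ∀ a ∈ cs.Roots, ∀ y ∈ F, ∀ y' ∈ F, (0 : ℝ) < inner ℝ a (y - x) →
      (0 : ℝ) ≤ inner ℝ a (y' - x) := by
    intro a ha y hy y' hy' hpos
    rw [inner_sub_right] at hpos ⊢
    have hM : cs.IsModelWall {z | (inner ℝ a z : ℝ) = inner ℝ a x} :=
      isModelWall_iff.2 ⟨a, ha, _, rfl⟩
    have hy1 := mem_iInter₂.1 hy _ ⟨hM, rfl⟩
    have hy2 := mem_iInter₂.1 hy' _ ⟨hM, rfl⟩
    rcases hσ _ hM rfl with h | h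
    · rw [h, mem_ofPred_eq] at hy1
      linarith
    · have := h.one_sided ha hy1 hy2 (by linarith)
      linarith
  -- a vector lying strictly on the side of `F` for each root that does not vanish on `F`
  have hv : ∃ v : ModelSpace n, ∀ a ∈ cs.Roots, (∃ y ∈ F, (0 : ℝ) < inner ℝ a (y - x)) →
      (0 : ℝ) < inner ℝ a v := by
    classical
    have hfin := finite_Roots cs
    choose! f hf using fun (a : ModelSpace n) (h : ∃ y ∈ F, (0 : ℝ) < inner ℝ a (y - x)) => h
    let T := hfin.toFinset.filter fun a => ∃ y ∈ F, (0 : ℝ) < inner ℝ a (y - x)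
    refine ⟨∑ b ∈ T, (f b - x), fun a ha h => ?_⟩
    rw [inner_sum]
    apply Finset.sum_pos'
    · intro b hb
      have hb' := (Finset.mem_filter.1 hb).2
      obtain ⟨y, hy, hpos⟩ := h
      exact hside a ha y hy _ (hf b hb').1 hpos
    · exact ⟨a, Finset.mem_filter.2 ⟨hfin.mem_toFinset.2 ha, h⟩, (hf a h).2⟩
  obtain ⟨v, hv⟩ := hv
  obtain ⟨u, hu, huv⟩ := exists_reg_perturb cs v
  refine ⟨u, hu, fun y hy a ha hpos => ?_⟩
  by_contra hn
  have := huv _ (Roots_neg ha) (hv _ (Roots_neg ha) ⟨y, hy, by rw [inner_neg_left]; linarith⟩)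
  rw [inner_neg_left] at this
  linarith

theorem IsModelSector.exists_reg {x : ModelSpace n} {F : Set (ModelSpace n)}
    (hF : cs.IsModelSector x F) : ∃ u, cs.Reg u ∧ F = {y | y - x ∈ cs.Ch u} := by
  obtain ⟨u, hu, hsub⟩ := hF.1.exists_reg_subset
  exact ⟨u, hu, (hF.2 _ (isModelSectorFace_Ch x u hu) hsub).symm⟩

theorem isModelSector_Ch (x u : ModelSpace n) (hu : cs.Reg u) :
    cs.IsModelSector x {y | y - x ∈ cs.Ch u} := by
  refine ⟨isModelSectorFace_Ch x u hu, fun F' hF' hsub => ?_⟩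
  obtain ⟨u', hu', hsub'⟩ := hF'.exists_reg_subset
  have hmem : u ∈ cs.Ch u' := by
    have : x + u ∈ {y | y - x ∈ cs.Ch u} := by
      rw [mem_ofPred_eq, add_sub_cancel_left]; exact self_mem_Ch u
    have := hsub' (hsub this)
    rwa [mem_ofPred_eq, add_sub_cancel_left] at this
  rw [hu'.Ch_eq_of_mem hu hmem] at hsub'
  exact hsub'.antisymm hsub

end SphericalCoxeterSystem

namespace SphericalCoxeterSystem

variable {n : ℕ} (cs : SphericalCoxeterSystem n)

/-- `p` lies in the relative interior of the panel of the chamber of `u` in the wall orthogonal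
to the root `a`. -/
structure Wall (u a p : ModelSpace n) : Prop where
  reg : cs.Reg u
  root : a ∈ cs.Roots
  inner_eq : (inner ℝ a p : ℝ) = 0
  pos : ∀ b ∈ cs.Roots, b ≠ a → b ≠ -a → (0 : ℝ) < inner ℝ b u * inner ℝ b p

variable {cs}

theorem inner_self_root {a : ModelSpace n} (ha : a ∈ cs.Roots) : inner ℝ a a = (1 : ℝ) := by
  rw [real_inner_self_eq_norm_sq, norm_of_mem_Roots ha]; norm_num

theorem eq_or_eq_neg_of_perp {a b : ModelSpace n} (ha : a ∈ cs.Roots) (hb : b ∈ cs.Roots)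
    (h : ∀ y : ModelSpace n, (inner ℝ a y : ℝ) = 0 → (0 : ℝ) ≤ inner ℝ b y) : b = a ∨ b = -a := by
  have h0 := h (-(b - (inner ℝ a b : ℝ) • a)) (by
    rw [inner_neg_right, inner_sub_right, inner_smul_right, inner_self_root ha]; ring)
  rw [inner_neg_right, inner_sub_right, inner_smul_right, inner_self_root hb,
    real_inner_comm a b] at h0
  set c : ℝ := inner ℝ a b with hc
  have h3 : b = c • a := by
    have : ‖b - c • a‖ ^ 2 = 0 := by
      have h2 : ‖b - c • a‖ ^ 2 = 1 - c * c := by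
        rw [norm_sub_sq_real, norm_smul, norm_of_mem_Roots ha, norm_of_mem_Roots hb,
          inner_smul_right, real_inner_comm, ← hc, Real.norm_eq_abs, mul_one, sq_abs]
        ring
      have := sq_nonneg ‖b - c • a‖
      linarith
    rw [← sub_eq_zero, ← norm_eq_zero]
    exact pow_eq_zero_iff (two_ne_zero) |>.1 this
  have h5 : |c| = 1 := by
    have := congrArg norm h3
    rw [norm_smul, norm_of_mem_Roots ha, norm_of_mem_Roots hb, mul_one] at this
    exact this.symm
  rcases (abs_eq (zero_le_one)).1 h5 with h | h <;> rw [h] at h3 <;> simp [h3]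

theorem Wall.refl_self {u a p : ModelSpace n} (h : cs.Wall u a p) : reflAlong a p = p :=
  reflAlong_eq_self (norm_of_mem_Roots h.root) h.inner_eq

theorem Wall.refl_mem {u a p : ModelSpace n} (h : cs.Wall u a p) : reflAlong a ∈ cs.Lin :=
  reflAlong_mem_Lin h.root

theorem reflAlong_inv (a : ModelSpace n) : (reflAlong a)⁻¹ = reflAlong a := by
  ext1 x
  apply (reflAlong a).injective
  rw [reflAlong_reflAlong]
  exact (reflAlong a).apply_symm_apply x

theorem Wall.reg_refl {u a p : ModelSpace n} (h : cs.Wall u a p) : cs.Reg (reflAlong a u) :=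
  h.reg.map h.refl_mem

theorem Wall.same_side {u a p : ModelSpace n} (h : cs.Wall u a p) {b : ModelSpace n}
    (hb : b ∈ cs.Roots) (h1 : b ≠ a) (h2 : b ≠ -a) :
    (0 : ℝ) < inner ℝ b (reflAlong a u) * inner ℝ b p := by
  have hra : reflAlong a a = -a := by
    rw [reflAlong_apply (norm_of_mem_Roots h.root), inner_self_root h.root]; module
  have := h.pos _ (Roots_map h.refl_mem hb) (by
      intro h3
      apply h2
      rw [← reflAlong_reflAlong a b, h3, hra]) (by
      intro h3
      apply h1
      rw [← reflAlong_reflAlong a b, h3, map_neg, hra, neg_neg])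
  rw [inner_map_inv, reflAlong_inv]
  have h4 : (inner ℝ b p : ℝ) = inner ℝ (reflAlong a b) p := by
    conv_lhs => rw [← h.refl_self]
    rw [inner_map_inv, reflAlong_inv]
  rwa [h4]

theorem Wall.refl {u a p : ModelSpace n} (h : cs.Wall u a p) : cs.Wall (reflAlong a u) a p :=
  ⟨h.reg_refl, h.root, h.inner_eq, fun _ hb h1 h2 => h.same_side hb h1 h2⟩

theorem Wall.neg {u a p : ModelSpace n} (h : cs.Wall u a p) : cs.Wall (-u) a (-p) :=
  ⟨h.reg.neg, h.root, by rw [inner_neg_right, h.inner_eq, neg_zero], fun b hb h1 h2 => by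
    rw [inner_neg_right, inner_neg_right, neg_mul_neg]; exact h.pos b hb h1 h2⟩

/-- Near the interior of a panel, a chamber is a half-space. -/
theorem Wall.exists_smul_add_mem_Ch {u a p : ModelSpace n} (h : cs.Wall u a p) :
    ∃ C : ℝ, 0 < C ∧ ∀ (w : ModelSpace n) (t : ℝ),
      (0 : ℝ) ≤ inner ℝ a u * inner ℝ a w → C * ‖w‖ ≤ t → t • p + w ∈ cs.Ch u := by
  obtain ⟨m, hm, hmb⟩ := exists_le_abs_inner cs p
  refine ⟨m⁻¹, inv_pos.2 hm, fun w t hw ht b hb hp => ?_⟩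
  rw [inner_add_right, inner_smul_right]
  by_cases h1 : b = a
  · subst h1
    rw [h.inner_eq, mul_zero, zero_add]
    exact nonneg_of_mul_nonneg_right hw hp
  by_cases h2 : b = -a
  · subst h2
    rw [inner_neg_left] at hp ⊢
    rw [inner_neg_left, h.inner_eq, neg_zero, mul_zero, zero_add]
    nlinarith
  have h3 := h.pos b hb h1 h2
  have h4 : (0 : ℝ) < inner ℝ b p := pos_of_mul_pos_right h3 hp.le
  have h5 := hmb b hb h4.ne'
  rw [abs_of_pos h4] at h5
  have h6 := neg_le_of_abs_le (abs_inner_root_le hb w)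
  rw [inv_mul_le_iff₀ hm] at ht
  have ht0 : 0 ≤ t := by
    by_contra hn
    have := norm_nonneg w
    nlinarith
  nlinarith

theorem Wall.mem_Ch {u a p : ModelSpace n} (h : cs.Wall u a p) : p ∈ cs.Ch u := by
  obtain ⟨C, hC, hCh⟩ := h.exists_smul_add_mem_Ch
  have := hCh 0 1 (by simp) (by simp)
  simpa using this

/-- A linear isometry fixing a panel pointwise is the identity or the reflection. -/
theorem Wall.eq_one_or_eq_refl {u a p : ModelSpace n} (h : cs.Wall u a p)
    (L : ModelSpace n ≃ₗᵢ[ℝ] ModelSpace n)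
    (hL : ∀ v ∈ cs.Ch u, v ∈ cs.Ch (reflAlong a u) → L v = v) :
    (∀ x, L x = x) ∨ ∀ x, L x = reflAlong a x := by
  obtain ⟨C, hC, hCh⟩ := h.exists_smul_add_mem_Ch
  obtain ⟨C', hC', hCh'⟩ := h.refl.exists_smul_add_mem_Ch
  refine eq_one_or_eq_reflAlong (norm_of_mem_Roots h.root) L fun w hw => ?_
  have h1 : ∀ w : ModelSpace n, (inner ℝ a w : ℝ) = 0 → C * ‖w‖ ≤ (C + C') * ‖w‖ ∧
      C' * ‖w‖ ≤ (C + C') * ‖w‖ := fun w _ => by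
    have := norm_nonneg w
    constructor <;> nlinarith
  have e1 := hL _ (hCh w ((C + C') * ‖w‖) (by rw [hw, mul_zero]) (h1 w hw).1)
    (hCh' w ((C + C') * ‖w‖) (by rw [hw, mul_zero]) (h1 w hw).2)
  have e2 := hL _ h.mem_Ch h.refl.mem_Ch
  rw [map_add, map_smul, e2] at e1
  exact add_left_cancel e1

/-- A chamber not containing the regular vector `u'` has a wall separating it from `u'`. -/
theorem exists_wall_separating {u u' : ModelSpace n} (hu : cs.Reg u) (hu' : u' ∉ cs.Ch u) :
    ∃ a p, cs.Wall u a p ∧ (0 : ℝ) < inner ℝ a u ∧ (inner ℝ a u' : ℝ) < 0 := by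
  classical
  set Ψ : Set (ModelSpace n) := {b ∈ cs.Roots | (0 : ℝ) < inner ℝ b u} with hΨ
  have hΨfin : Ψ.Finite := (finite_Roots cs).subset (sep_subset _ _)
  let 𝓣 : Set (Set (ModelSpace n)) := {T | T ⊆ Ψ ∧ ∀ x : ModelSpace n,
    (∀ b ∈ T, (0 : ℝ) ≤ inner ℝ b x) → x ∈ cs.Ch u}
  have hfin : 𝓣.Finite := hΨfin.finite_subsets.subset fun T hT => hT.1
  obtain ⟨T, ⟨hTΨ, hT⟩, hmin⟩ := hfin.exists_minimal
    ⟨Ψ, Subset.rfl, fun x hx b hb hp => hx b ⟨hb, hp⟩⟩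
  obtain ⟨a, haT, hau'⟩ : ∃ a ∈ T, (inner ℝ a u' : ℝ) < 0 := by
    by_contra! h
    exact hu' (hT u' h)
  obtain ⟨haR, hau⟩ := hTΨ haT
  obtain ⟨x, hx, hxu⟩ : ∃ x : ModelSpace n, (∀ b ∈ T \ {a}, (0 : ℝ) ≤ inner ℝ b x) ∧
      x ∉ cs.Ch u := by
    by_contra! h
    have : T \ {a} ∈ 𝓣 := ⟨sdiff_subset.trans hTΨ, h⟩
    have := hmin this sdiff_subset haT
    exact this.2 rfl
  have hax : (inner ℝ a x : ℝ) < 0 := by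
    by_contra! h
    exact hxu (hT x fun b hb => if hba : b = a then hba ▸ h else hx b ⟨hb, hba⟩)
  set p : ModelSpace n := (-(inner ℝ a x : ℝ)) • u + (inner ℝ a u : ℝ) • x with hp
  have hap : (inner ℝ a p : ℝ) = 0 := by
    rw [hp, inner_add_right, inner_smul_right, inner_smul_right]; ring
  have hbp : ∀ b ∈ T, b ≠ a → (0 : ℝ) < inner ℝ b p := by
    intro b hb hba
    have h1 := hx b ⟨hb, hba⟩
    have h2 := (hTΨ hb).2
    rw [hp, inner_add_right, inner_smul_right, inner_smul_right]
    nlinarith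
  have hpCh : p ∈ cs.Ch u := hT p fun b hb => by
    by_cases hba : b = a
    · rw [hba, hap]
    · exact (hbp b hb hba).le
  have hpos : ∀ b ∈ cs.Roots, (0 : ℝ) < inner ℝ b u → b ≠ a → (0 : ℝ) < inner ℝ b p := by
    intro b hb hbu hba
    refine lt_of_le_of_ne (hpCh b hb hbu) fun h0 => ?_
    have hperp : ∀ y : ModelSpace n, (inner ℝ a y : ℝ) = 0 → (0 : ℝ) ≤ inner ℝ b y := by
      intro y hy
      have hev : ∀ᶠ s : ℝ in nhdsWithin 0 (Ioi 0), ∀ c ∈ T,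
          (0 : ℝ) ≤ inner ℝ c (p + s • y) := by
        refine (Filter.eventually_all_finite (hΨfin.subset hTΨ)).2 fun c hc => ?_
        by_cases hca : c = a
        · refine Filter.Eventually.of_forall fun s => ?_
          rw [hca, inner_add_right, inner_smul_right, hap, hy, mul_zero, add_zero]
        · have hcont : Continuous (fun s : ℝ => (inner ℝ c (p + s • y) : ℝ)) := by fun_prop
          have := hcont.tendsto 0
          simp only [zero_smul, add_zero] at this
          filter_upwards [(this.mono_left nhdsWithin_le_nhds).eventually
            (Ioi_mem_nhds (hbp c hc hca))] with s hs using le_of_lt hs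
      obtain ⟨s, hs, hs0⟩ := (hev.and self_mem_nhdsWithin).exists
      have := hT _ hs b hb hbu
      rw [inner_add_right, ← h0, zero_add, inner_smul_right] at this
      exact nonneg_of_mul_nonneg_right this hs0
    rcases eq_or_eq_neg_of_perp haR hb hperp with h | h
    · exact hba h
    · rw [h, inner_neg_left] at hbu
      linarith
  refine ⟨a, p, ⟨hu, haR, hap, fun b hb h1 h2 => ?_⟩, hau, hau'⟩
  rcases lt_or_gt_of_ne (hu b hb) with h | h
  · have := hpos (-b) (Roots_neg hb) (by rw [inner_neg_left]; linarith) (fun h3 => h2 (by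
      rw [← h3, neg_neg]))
    rw [inner_neg_left] at this
    nlinarith
  · exact mul_pos h (hpos b hb h h1)

/-- The number of roots separating two vectors. -/
def sepCount (cs : SphericalCoxeterSystem n) (u u' : ModelSpace n) : ℕ :=
  {b ∈ cs.Roots | (inner ℝ b u * inner ℝ b u' : ℝ) < 0}.ncard

theorem Wall.sepCount_lt {u u' a p : ModelSpace n} (h : cs.Wall u a p)
    (h1 : (0 : ℝ) < inner ℝ a u) (h2 : (inner ℝ a u' : ℝ) < 0) :
    sepCount cs (reflAlong a u) u' < sepCount cs u u' := by
  refine ncard_lt_ncard ?_ ((finite_Roots cs).subset (sep_subset _ _))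
  have hra := inner_reflAlong (norm_of_mem_Roots h.root) u
  refine (ssubset_iff_of_subset ?_).2 ⟨a, ⟨h.root, mul_neg_of_pos_of_neg h1 h2⟩, ?_⟩
  · rintro b ⟨hb, hneg⟩
    refine ⟨hb, ?_⟩
    have hba : b ≠ a := by
      rintro rfl
      rw [hra] at hneg
      nlinarith
    have hbna : b ≠ -a := by
      rintro rfl
      rw [inner_neg_left, inner_neg_left, hra] at hneg
      nlinarith
    have h3 := h.pos b hb hba hbna
    have h4 := h.same_side hb hba hbna
    by_contra hn
    rw [not_lt] at hn
    have h5 : (0 : ℝ) < inner ℝ b u * inner ℝ b (reflAlong a u) := by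
      have h6 := mul_pos h3 h4
      have h7 : (0 : ℝ) < (inner ℝ b u * inner ℝ b (reflAlong a u)) * (inner ℝ b p) ^ 2 := by
        nlinarith
      exact pos_of_mul_pos_left h7 (sq_nonneg _)
    have h6 := mul_nonneg hn h5.le
    have hu := h.reg b hb
    have h8 : 0 < (inner ℝ b u : ℝ) ^ 2 := by positivity
    nlinarith
  · rintro ⟨-, h3⟩
    rw [hra] at h3
    nlinarith

section Convexity

variable {S : Set (ModelSpace n)}

theorem add_mem_of_recession (hc : IsClosed S) (hS : Convex ℝ S) {x z v : ModelSpace n}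
    (hz : ∀ t : ℝ, 0 ≤ t → z + t • v ∈ S) (hx : x ∈ S) : x + v ∈ S := by
  have hcont : Continuous (fun s : ℝ => x + s • (z - x) + v) := by fun_prop
  have ht := hcont.tendsto 0
  simp only [zero_smul, add_zero] at ht
  refine hc.mem_of_tendsto (ht.mono_left (nhdsWithin_le_nhds (s := Ioi 0))) ?_
  filter_upwards [self_mem_nhdsWithin, mem_nhdsWithin_of_mem_nhds (Iio_mem_nhds one_pos)]
    with s hs0 hs1
  rw [mem_Ioi] at hs0
  rw [mem_Iio] at hs1
  have := hS hx (hz s⁻¹ (inv_nonneg.2 hs0.le)) (by linarith : 0 ≤ 1 - s) hs0.le (by ring)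
  convert this using 1
  rw [smul_add, smul_smul, mul_inv_cancel₀ hs0.ne']
  module

theorem add_mem_of_translate_subset (hc : IsClosed S) (hS : Convex ℝ S) {u x z v : ModelSpace n}
    (hz : ∀ w ∈ cs.Ch u, z + w ∈ S) (hx : x ∈ S) (hv : v ∈ cs.Ch u) : x + v ∈ S :=
  add_mem_of_recession hc hS (fun _ ht => hz _ (smul_mem_Ch ht hv)) hx

/-- A closed convex set containing translates of a chamber and of the opposite of its neighbour
is upward closed in the direction of the common wall. -/
theorem Wall.upward_closed (hc : IsClosed S) (hS : Convex ℝ S) {u a p z₁ z₂ : ModelSpace n}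
    (h : cs.Wall u a p) (h0 : (0 : ℝ) < inner ℝ a u) (h1 : ∀ w ∈ cs.Ch u, z₁ + w ∈ S)
    (h2 : ∀ w ∈ cs.Ch (-reflAlong a u), z₂ + w ∈ S) {x y : ModelSpace n} (hx : x ∈ S)
    (hxy : (inner ℝ a x : ℝ) ≤ inner ℝ a y) : y ∈ S := by
  obtain ⟨C, hC, hCh⟩ := h.exists_smul_add_mem_Ch
  have h3 := hCh (y - x) (C * ‖y - x‖)
    (mul_nonneg h0.le (by rw [inner_sub_right]; linarith)) le_rfl
  have h4 : (C * ‖y - x‖) • -p ∈ cs.Ch (-reflAlong a u) :=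
    smul_mem_Ch (by positivity) h.refl.neg.mem_Ch
  have h5 := add_mem_of_translate_subset hc hS h2
    (add_mem_of_translate_subset hc hS h1 hx h3) h4
  convert h5 using 1
  module

theorem Wall.eq_univ_or_halfSpace (hc : IsClosed S) (hS : Convex ℝ S) {u a p z₁ z₂ : ModelSpace n}
    (h : cs.Wall u a p) (h0 : (0 : ℝ) < inner ℝ a u) (h1 : ∀ w ∈ cs.Ch u, z₁ + w ∈ S)
    (h2 : ∀ w ∈ cs.Ch (-reflAlong a u), z₂ + w ∈ S) :
    S = univ ∨ ∃ c : ℝ, S = {x | c ≤ inner ℝ a x} := by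
  have hup : ∀ x y, x ∈ S → (inner ℝ a x : ℝ) ≤ inner ℝ a y → y ∈ S :=
    fun x y hx hxy => h.upward_closed hc hS h0 h1 h2 hx hxy
  have haa := inner_self_root h.root
  have hne : ((fun x : ModelSpace n => (inner ℝ a x : ℝ)) '' S).Nonempty :=
    ⟨_, z₁ + 0, h1 0 (zero_mem_Ch u), rfl⟩
  by_cases hb : BddBelow ((fun x : ModelSpace n => (inner ℝ a x : ℝ)) '' S)
  · right
    set c := sInf ((fun x : ModelSpace n => (inner ℝ a x : ℝ)) '' S) with hcdef
    refine ⟨c, Subset.antisymm (fun x hx => csInf_le hb ⟨x, hx, rfl⟩) fun x hx => ?_⟩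
    rw [mem_ofPred_eq] at hx
    have hcont : Continuous (fun s : ℝ => x + s • a) := by fun_prop
    have ht := hcont.tendsto 0
    simp only [zero_smul, add_zero] at ht
    refine hc.mem_of_tendsto (ht.mono_left (nhdsWithin_le_nhds (s := Ioi 0))) ?_
    filter_upwards [self_mem_nhdsWithin] with s hs0
    rw [mem_Ioi] at hs0
    obtain ⟨_, ⟨y, hy, rfl⟩, hlt⟩ := exists_lt_of_csInf_lt hne
      (show c < c + s by linarith)
    refine hup y _ hy ?_
    rw [inner_add_right, inner_smul_right, haa]
    simp only at hlt
    linarith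
  · left
    rw [eq_univ_iff_forall]
    intro x
    rw [not_bddBelow_iff] at hb
    obtain ⟨_, ⟨y, hy, rfl⟩, hlt⟩ := hb (inner ℝ a x)
    exact hup y x hy (le_of_lt hlt)

end Convexity

end SphericalCoxeterSystem

section Charts

open SphericalCoxeterSystem Filter Topology

variable {n : ℕ} {cs : SphericalCoxeterSystem n} {X : Type*}

/-- Two maps agree on a translate of the chamber of `u`. -/
def Asym (cs : SphericalCoxeterSystem n) (f g : ModelSpace n → X) (u : ModelSpace n) : Prop :=
  ∃ z, ∀ v ∈ cs.Ch u, f (z + v) = g (z + v)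

/-- Two maps agree wherever the image of the first meets that of the second. -/
def Coherent (f g : ModelSpace n → X) : Prop := ∀ x, f x ∈ range g → f x = g x

theorem Asym.rfl' {f : ModelSpace n → X} {u : ModelSpace n} : Asym cs f f u := ⟨0, fun _ _ => rfl⟩

theorem Asym.symm {f g : ModelSpace n → X} {u : ModelSpace n} (h : Asym cs f g u) :
    Asym cs g f u := h.imp fun _ h v hv => (h v hv).symm

theorem Asym.congr_Ch {f g : ModelSpace n → X} {u u' : ModelSpace n} (h : Asym cs f g u)
    (he : cs.Ch u = cs.Ch u') : Asym cs f g u' := by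
  obtain ⟨z, hz⟩ := h
  exact ⟨z, fun v hv => hz v (he ▸ hv)⟩

theorem Asym.deep {f g : ModelSpace n → X} {u : ModelSpace n} (h : Asym cs f g u)
    (y : ModelSpace n) : ∃ T : ℝ, 0 < T ∧ ∀ t, T ≤ t → ∀ v ∈ cs.Ch u,
      f (y + t • u + v) = g (y + t • u + v) := by
  obtain ⟨z, hz⟩ := h
  obtain ⟨C, hC, hCh⟩ := exists_smul_add_mem_Ch cs u
  refine ⟨C * ‖y - z‖ + 1, by positivity, fun t ht v hv => ?_⟩
  have := hz _ (add_mem_Ch (hCh (y - z) t (by linarith)) hv)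
  rwa [show z + (t • u + (y - z) + v) = y + t • u + v by abel] at this

theorem Asym.trans {f g h : ModelSpace n → X} {u : ModelSpace n} (h1 : Asym cs f g u)
    (h2 : Asym cs g h u) : Asym cs f h u := by
  obtain ⟨T1, -, H1⟩ := h1.deep 0
  obtain ⟨T2, -, H2⟩ := h2.deep 0
  exact ⟨0 + (max T1 T2) • u, fun v hv => (H1 _ (le_max_left _ _) v hv).trans
    (H2 _ (le_max_right _ _) v hv)⟩

theorem Asym.reparam {f g : ModelSpace n → X} {u : ModelSpace n}
    {L : ModelSpace n ≃ₗᵢ[ℝ] ModelSpace n} (hL : L ∈ cs.Lin) (c : ModelSpace n)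
    (h : Asym cs f g (L u)) : Asym cs (fun x => f (L x + c)) (fun x => g (L x + c)) u := by
  obtain ⟨z, hz⟩ := h
  refine ⟨L⁻¹ (z - c), fun v hv => ?_⟩
  have := hz _ (map_mem_Ch hL hv)
  have he : L (L⁻¹ (z - c) + v) + c = z + L v := by
    rw [map_add, show L (L⁻¹ (z - c)) = z - c from L.apply_symm_apply _]; abel
  beta_reduce
  rwa [he]

theorem Asym.shift {f g : ModelSpace n → X} {u : ModelSpace n} (c : ModelSpace n)
    (h : Asym cs f g u) : Asym cs (fun x => f (x + c)) (fun x => g (x + c)) u :=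
  Asym.reparam (one_mem cs.Lin) c h

theorem Coherent.asym_of_shift {f g : ModelSpace n → X} {u c : ModelSpace n} (h : Coherent f g)
    (h1 : Asym cs (fun x => f (x + c)) g u) : Asym cs f g u := by
  obtain ⟨z, hz⟩ := h1
  refine ⟨z + c, fun v hv => h _ ⟨z + v, ?_⟩⟩
  rw [← hz v hv]
  beta_reduce
  rw [add_right_comm]

theorem Coherent.setOf_eq {f g : ModelSpace n → X} (h : Coherent f g) :
    {x | f x = g x} = {x | f x ∈ range g} :=
  Subset.antisymm (fun x hx => ⟨x, Eq.symm hx⟩) fun x hx => h x hx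

theorem not_asym_of_half {f g : ModelSpace n → X} {a u : ModelSpace n} {c : ℝ}
    (h : {x | f x = g x} = {x | c ≤ inner ℝ a x}) (hu : (inner ℝ a u : ℝ) < 0) :
    ¬ Asym cs f g u := by
  rintro ⟨z, hz⟩
  have h1 : z + ((|(inner ℝ a z : ℝ) - c| + 1) / -inner ℝ a u : ℝ) • u ∈ {x | f x = g x} :=
    hz _ (smul_mem_Ch (div_nonneg (by positivity) (by linarith)) (self_mem_Ch u))
  rw [h, mem_ofPred_eq, inner_add_right, inner_smul_right, div_mul_eq_mul_div, mul_div_assoc,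
    div_neg, div_self hu.ne] at h1
  have := le_abs_self ((inner ℝ a z : ℝ) - c)
  linarith

variable [MetricSpace X] {Λ : Set X}

namespace RBuilding

variable (B : RBuilding cs X Λ)

theorem chart_comp {f : ModelSpace n → X} (hf : f ∈ B.charts)
    {L : ModelSpace n ≃ₗᵢ[ℝ] ModelSpace n} (hL : L ∈ cs.Lin) (c : ModelSpace n) :
    (fun x => f (L x + c)) ∈ B.charts := by
  obtain ⟨w, hw, h⟩ := exists_mem_W hL c
  have := B.A1 f hf w hw
  rwa [show f ∘ w = fun x => f (L x + c) from funext fun x => congrArg f (h x)] at this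

theorem chart_shift {f : ModelSpace n → X} (hf : f ∈ B.charts) (c : ModelSpace n) :
    (fun x => f (x + c)) ∈ B.charts := B.chart_comp hf (one_mem cs.Lin) c

theorem exists_transition {f g : ModelSpace n → X} (hf : f ∈ B.charts) (hg : g ∈ B.charts) :
    ∃ L ∈ cs.Lin, ∃ c, ∀ x, f x ∈ range g → f x = g (L x + c) := by
  obtain ⟨-, -, w, hw, h⟩ := B.A2 f hf g hg
  obtain ⟨L, hL, c, h'⟩ := exists_lin_of_mem_W hw
  exact ⟨L, hL, c, fun x hx => by rw [h x hx, h']⟩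

variable {B}

theorem inj {f : ModelSpace n → X} (hf : f ∈ B.charts) : Function.Injective f :=
  (B.isom f hf).injective

theorem coherent_of_germ {f g : ModelSpace n → X} (hf : f ∈ B.charts) (hg : g ∈ B.charts)
    {z e : ModelSpace n} {ε : ℝ} (hε : 0 < ε)
    (h : ∀ v ∈ cs.Ch e, ‖v‖ < ε → f (z + v) = g (z + v)) : Coherent f g := by
  obtain ⟨L, hL, c, hLc⟩ := B.exists_transition hf hg
  have h0 : L z + c = z := by
    have h1 := h 0 (zero_mem_Ch e) (by simpa using hε)
    rw [add_zero] at h1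
    exact inj hg ((hLc z ⟨z, h1.symm⟩).symm.trans h1)
  have hL1 := eq_id_of_eqOn_Ch hε L fun v hv hvε => by
    have h1 := h v hv hvε
    have h2 := inj hg ((hLc (z + v) ⟨z + v, h1.symm⟩).symm.trans h1)
    rw [map_add, add_right_comm, h0] at h2
    exact add_left_cancel h2
  intro x hx
  rw [hLc x hx]
  have : c = 0 := by rw [hL1] at h0; simpa using h0
  rw [hL1, this, add_zero]

theorem coherent_of_asym {f g : ModelSpace n → X} (hf : f ∈ B.charts) (hg : g ∈ B.charts)
    {e : ModelSpace n} (h : Asym cs f g e) : Coherent f g := by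
  obtain ⟨z, hz⟩ := h
  exact coherent_of_germ hf hg one_pos fun v hv _ => hz v hv

theorem isClosed_agree {f g : ModelSpace n → X} (hf : f ∈ B.charts) (hg : g ∈ B.charts)
    (h : Coherent f g) : IsClosed {x | f x = g x} := by
  rw [h.setOf_eq]; exact (B.A2 f hf g hg).1

theorem convex_agree {f g : ModelSpace n → X} (hf : f ∈ B.charts) (hg : g ∈ B.charts)
    (h : Coherent f g) : Convex ℝ {x | f x = g x} := by
  rw [h.setOf_eq]; exact (B.A2 f hf g hg).2.1

/-- A sector contained in an apartment is a translated chamber of any chart of it. -/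
theorem exists_eq_image_of_subset {α : X} {T : Set X} (hT : IsSectorAt cs B.charts α T)
    {f : ModelSpace n → X} (hf : f ∈ B.charts) (hTf : T ⊆ range f) :
    ∃ z u, cs.Reg u ∧ f z = α ∧ T = f '' {y | y - z ∈ cs.Ch u} := by
  obtain ⟨g, hg, x, s, hs, rfl, rfl⟩ := hT
  obtain ⟨u, hu, rfl⟩ := hs.exists_reg
  obtain ⟨L, hL, c, hLc⟩ := B.exists_transition hg hf
  have hmem : ∀ y, y - x ∈ cs.Ch u → g y = f (L y + c) := fun y hy => hLc y (hTf ⟨y, hy, rfl⟩)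
  have hsub : ∀ y, (L y + c) - (L x + c) = L (y - x) := fun y => by rw [map_sub]; abel
  refine ⟨L x + c, L u, hu.map hL, (hmem x (by rw [sub_self]; exact zero_mem_Ch u)).symm, ?_⟩
  ext q
  constructor
  · rintro ⟨y, hy, rfl⟩
    refine ⟨L y + c, ?_, (hmem y hy).symm⟩
    rw [mem_ofPred_eq, hsub]
    exact map_mem_Ch hL hy
  · rintro ⟨y, hy, rfl⟩
    have hy' : L (L⁻¹ (y - c)) + c = y := by
      rw [show L (L⁻¹ (y - c)) = y - c from L.apply_symm_apply _]; abel
    rw [mem_ofPred_eq, ← hy', hsub, map_mem_Ch_iff hL] at hy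
    refine ⟨L⁻¹ (y - c), hy, ?_⟩
    rw [hmem _ hy, hy']

theorem exists_asym_of_subsector {f m : ModelSpace n → X} (hf : f ∈ B.charts) (hm : m ∈ B.charts)
    {u : ModelSpace n} (hu : cs.Reg u) {T : Set X} (hT : IsSector cs B.charts T)
    (hTf : T ⊆ f '' {y | y - 0 ∈ cs.Ch u}) (hTm : T ⊆ range m) :
    ∃ L ∈ cs.Lin, ∃ c, Asym cs (fun x => m (L x + c)) f u := by
  obtain ⟨α, hT⟩ := hT
  obtain ⟨z, w, hw, -, rfl⟩ := exists_eq_image_of_subset hT hf (hTf.trans (image_subset_range _ _))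
  have hzw : ∀ y, y - z ∈ cs.Ch w → y ∈ cs.Ch u := by
    intro y hy
    obtain ⟨y', hy', he⟩ := hTf ⟨y, hy, rfl⟩
    rw [inj hf he, mem_ofPred_eq, sub_zero] at hy'
    exact hy'
  have hwu : w ∈ cs.Ch u := by
    intro a ha hp
    by_contra! hn
    have hz : z ∈ cs.Ch u := hzw z (by rw [sub_self]; exact zero_mem_Ch w)
    have h1 := hz a ha hp
    have h2 := hzw (z + ((inner ℝ a z + 1) / -inner ℝ a w : ℝ) • w) (by
      rw [add_sub_cancel_left]
      exact smul_mem_Ch (div_nonneg (by linarith) (by linarith)) (self_mem_Ch w)) a ha hp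
    rw [inner_add_right, inner_smul_right, div_mul_eq_mul_div, mul_div_assoc, div_neg,
      div_self hn.ne] at h2
    linarith
  have hCh := hu.Ch_eq_of_mem hw hwu
  obtain ⟨L, hL, c, hLc⟩ := B.exists_transition hf hm
  refine ⟨L, hL, c, z, fun v hv => (hLc _ (hTm ⟨z + v, ?_, rfl⟩)).symm⟩
  rw [mem_ofPred_eq, add_sub_cancel_left, ← hCh]
  exact hv

theorem exists_common_chart {f g : ModelSpace n → X} (hf : f ∈ B.charts) (hg : g ∈ B.charts)
    {u u' : ModelSpace n} (hu : cs.Reg u) (hu' : cs.Reg u') :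
    ∃ m ∈ B.charts, Asym cs m f u ∧ ∃ L ∈ cs.Lin, ∃ c, Asym cs (fun x => m (L x + c)) g u' := by
  obtain ⟨T₁, T₂, m, hm, hT₁, hT₂, h1, h2, h3, h4⟩ := B.A4 (f '' {y | y - 0 ∈ cs.Ch u})
    (g '' {y | y - 0 ∈ cs.Ch u'}) ⟨f 0, f, hf, 0, _, isModelSector_Ch 0 u hu, rfl, rfl⟩
    ⟨g 0, g, hg, 0, _, isModelSector_Ch 0 u' hu', rfl, rfl⟩
  obtain ⟨L₁, hL₁, c₁, ha₁⟩ := exists_asym_of_subsector hf hm hu hT₁ h1 h3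
  obtain ⟨L₂, hL₂, c₂, ha₂⟩ := exists_asym_of_subsector hg hm hu' hT₂ h2 h4
  refine ⟨_, B.chart_comp hm hL₁ c₁, ha₁, L₁⁻¹ * L₂, mul_mem (inv_mem hL₁) hL₂, L₁⁻¹ (c₂ - c₁), ?_⟩
  have he : (fun x => m (L₂ x + c₂)) =
      fun x => m (L₁ ((L₁⁻¹ * L₂) x + L₁⁻¹ (c₂ - c₁)) + c₁) := by
    funext x
    congr 1
    rw [map_add, show L₁ ((L₁⁻¹ * L₂) x) = L₂ x from L₁.apply_symm_apply _,
      show L₁ (L₁⁻¹ (c₂ - c₁)) = c₂ - c₁ from L₁.apply_symm_apply _]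
    abel
  rwa [he] at ha₂

end RBuilding

end Charts

section Rays

open SphericalCoxeterSystem Filter Topology

variable {n : ℕ} {cs : SphericalCoxeterSystem n} {X : Type*}

/-- The ray of the map `f` in direction `v`. -/
def rayOf (f : ModelSpace n → X) (v : ModelSpace n) (t : ℝ) : X := f (t • v)

variable [MetricSpace X] {Λ : Set X}

/-- Two paths at bounded distance from each other. -/
def Near (ρ ρ' : ℝ → X) : Prop := ∃ K, ∀ t, 0 ≤ t → dist (ρ t) (ρ' t) ≤ K

/-- The path `ρ` has asymptotic position `a` as seen from the chamber of `u` of the map `k`. -/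
def Pos (cs : SphericalCoxeterSystem n) (k : ModelSpace n → X) (u : ModelSpace n) (ρ : ℝ → X)
    (a : ModelSpace n) : Prop :=
  ∀ x ∈ cs.Ch u, Tendsto (fun t : ℝ => dist (ρ t) (k (t • x)) / t) atTop (𝓝 ‖a - x‖)

theorem Near.symm {ρ ρ' : ℝ → X} (h : Near ρ ρ') : Near ρ' ρ := by
  obtain ⟨K, hK⟩ := h
  exact ⟨K, fun t ht => by rw [dist_comm]; exact hK t ht⟩

theorem Near.trans {ρ ρ' ρ'' : ℝ → X} (h : Near ρ ρ') (h' : Near ρ' ρ'') : Near ρ ρ'' := by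
  obtain ⟨K, hK⟩ := h
  obtain ⟨K', hK'⟩ := h'
  exact ⟨K + K', fun t ht => (dist_triangle _ _ _).trans (add_le_add (hK t ht) (hK' t ht))⟩

theorem tendsto_div_of_abs_sub_le {f g : ℝ → ℝ} {K l : ℝ} (h : ∀ t, 0 ≤ t → |f t - g t| ≤ K)
    (hf : Tendsto (fun t => f t / t) atTop (𝓝 l)) : Tendsto (fun t => g t / t) atTop (𝓝 l) := by
  have h0 : Tendsto (fun t : ℝ => K / t) atTop (𝓝 0) := tendsto_const_nhds.div_atTop tendsto_id
  have h1 : Tendsto (fun t => f t / t - g t / t) atTop (𝓝 0) := by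
    refine squeeze_zero_norm' ?_ h0
    filter_upwards [eventually_gt_atTop 0] with t ht
    rw [← sub_div, Real.norm_eq_abs, abs_div, abs_of_pos ht]
    exact div_le_div_of_nonneg_right (h t ht.le) ht.le
  simpa using hf.sub h1

theorem Pos.congr {k : ModelSpace n → X} {u a : ModelSpace n} {ρ ρ' : ℝ → X}
    (h : Pos cs k u ρ a) (hn : Near ρ ρ') : Pos cs k u ρ' a := by
  obtain ⟨K, hK⟩ := hn
  exact fun x hx => tendsto_div_of_abs_sub_le
    (fun t ht => (abs_dist_sub_le _ _ _).trans (hK t ht)) (h x hx)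

theorem eq_zero_of_perp_Ch {u w : ModelSpace n} (h : ∀ x ∈ cs.Ch u, (inner ℝ w x : ℝ) = 0) :
    w = 0 := by
  obtain ⟨C, hC, hCh⟩ := exists_smul_add_mem_Ch cs u
  have h1 := h _ (hCh w (C * ‖w‖) le_rfl)
  have h2 := h _ (hCh 0 (C * ‖w‖) (by rw [norm_zero, mul_zero]; positivity))
  rw [add_zero] at h2
  rw [inner_add_right, h2, zero_add] at h1
  exact inner_self_eq_zero.1 h1

theorem eq_of_norm_sub_eq {u a a' : ModelSpace n} (hd : ∀ x ∈ cs.Ch u, ‖a - x‖ = ‖a' - x‖) :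
    a = a' := by
  have h0 := hd 0 (zero_mem_Ch u)
  rw [sub_zero, sub_zero] at h0
  refine sub_eq_zero.1 (eq_zero_of_perp_Ch (cs := cs) (u := u) fun x hx => ?_)
  have := congrArg (· ^ 2) (hd x hx)
  simp only [norm_sub_sq_real, h0] at this
  rw [inner_sub_left]
  linarith

theorem Pos.unique {k : ModelSpace n → X} {u a a' : ModelSpace n} {ρ : ℝ → X}
    (h : Pos cs k u ρ a) (h' : Pos cs k u ρ a') : a = a' :=
  eq_of_norm_sub_eq (cs := cs) (u := u) fun x hx => tendsto_nhds_unique (h x hx) (h' x hx)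

namespace RBuilding

variable {B : RBuilding cs X Λ}

theorem near_of_asym {f g : ModelSpace n → X} (hf : f ∈ B.charts) (hg : g ∈ B.charts)
    {u v : ModelSpace n} (h : Asym cs f g u) (hv : v ∈ cs.Ch u) : Near (rayOf f v) (rayOf g v) := by
  obtain ⟨z, hz⟩ := h
  refine ⟨‖z‖ + ‖z‖, fun t ht => ?_⟩
  have h1 : dist (f (t • v)) (f (z + t • v)) ≤ ‖z‖ := by
    rw [(B.isom f hf).dist_eq, dist_eq_norm]; simp
  have h2 : dist (f (z + t • v)) (g (t • v)) ≤ ‖z‖ := by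
    rw [hz _ (smul_mem_Ch ht hv), (B.isom g hg).dist_eq, dist_eq_norm]; simp
  exact (dist_triangle _ _ _).trans (add_le_add h1 h2)

theorem near_reparam {f : ModelSpace n → X} (hf : f ∈ B.charts)
    (L : ModelSpace n ≃ₗᵢ[ℝ] ModelSpace n) (c v : ModelSpace n) :
    Near (rayOf (fun x => f (L x + c)) v) (rayOf f (L v)) := by
  refine ⟨‖c‖, fun t _ => ?_⟩
  simp only [rayOf]
  rw [(B.isom f hf).dist_eq, dist_eq_norm, map_smul]; simp

theorem pos_of_asym {k f : ModelSpace n → X} (hk : k ∈ B.charts) (hf : f ∈ B.charts)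
    {u : ModelSpace n} (h : Asym cs k f u) (v : ModelSpace n) : Pos cs k u (rayOf f v) v := by
  intro x hx
  obtain ⟨K, hK⟩ := near_of_asym hk hf h hx
  have h1 : Tendsto (fun t : ℝ => dist (f (t • v)) (f (t • x)) / t) atTop (𝓝 ‖v - x‖) := by
    refine tendsto_const_nhds.congr' ?_
    filter_upwards [eventually_gt_atTop 0] with t ht
    rw [(B.isom f hf).dist_eq, dist_eq_norm, ← smul_sub, norm_smul, Real.norm_of_nonneg ht.le,
      mul_div_cancel_left₀ _ ht.ne']
  refine tendsto_div_of_abs_sub_le (K := K) (fun t ht => ?_) h1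
  have h2 := hK t ht
  simp only [rayOf] at h2 ⊢
  rw [dist_comm] at h2
  rw [dist_comm (f (t • v)), dist_comm (f (t • v)) (k (t • x))]
  exact (abs_dist_sub_le _ _ _).trans h2

theorem exists_pos {k f : ModelSpace n → X} (hk : k ∈ B.charts) (hf : f ∈ B.charts)
    {u u' : ModelSpace n} (hu : cs.Reg u) (hu' : cs.Reg u') :
    ∃ L ∈ cs.Lin, ∀ v ∈ cs.Ch u', Pos cs k u (rayOf f v) (L v) := by
  obtain ⟨m, hm, h1, L, hL, c, h2⟩ := exists_common_chart hk hf hu hu'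
  refine ⟨L, hL, fun v hv => ?_⟩
  exact (pos_of_asym hk hm h1.symm (L v)).congr
    ((near_reparam hm L c v).symm.trans (near_of_asym (B.chart_comp hm hL c) hf h2 hv))

theorem eventually_common_Ch (cs : SphericalCoxeterSystem n) (x : ModelSpace n) :
    ∀ᶠ y in 𝓝 x, ∃ u, cs.Reg u ∧ x ∈ cs.Ch u ∧ y ∈ cs.Ch u := by
  have h : ∀ᶠ y in 𝓝 x, ∀ a ∈ cs.Roots, (0 : ℝ) < inner ℝ a x → (0 : ℝ) < inner ℝ a y := by
    refine (eventually_all_finite (finite_Roots cs)).2 fun a _ => ?_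
    by_cases h0 : (0 : ℝ) < inner ℝ a x
    · have hc : Continuous fun y : ModelSpace n => (inner ℝ a y : ℝ) := by fun_prop
      filter_upwards [(hc.tendsto x).eventually (Ioi_mem_nhds h0)] with y hy _ using hy
    · exact Eventually.of_forall fun y h => absurd h h0
  have hmem : ∀ {y u : ModelSpace n},
      (∀ a ∈ cs.Roots, (0 : ℝ) < inner ℝ a y → (0 : ℝ) < inner ℝ a u) →
      y ∈ cs.Ch u := by
    intro y u h a ha hp
    by_contra! hn
    have := h _ (Roots_neg ha) (by rw [inner_neg_left]; linarith)
    rw [inner_neg_left] at this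
    linarith
  filter_upwards [h] with y hy
  obtain ⟨u, hu, huy⟩ := exists_reg_perturb cs y
  exact ⟨u, hu, hmem fun a ha hp => huy a ha (hy a ha hp), hmem huy⟩

/-- Asymptotic positions depend in a `1`-Lipschitz way on the direction. -/
theorem norm_pos_sub_le {k f : ModelSpace n → X} (hk : k ∈ B.charts) (hf : f ∈ B.charts)
    {u : ModelSpace n} (hu : cs.Reg u) {v v' a a' : ModelSpace n}
    (h : Pos cs k u (rayOf f v) a) (h' : Pos cs k u (rayOf f v') a') : ‖a - a'‖ ≤ ‖v - v'‖ := by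
  have hex : ∀ v, ∃ a, Pos cs k u (rayOf f v) a := by
    intro v
    obtain ⟨u', hu', hv⟩ := exists_reg_mem_Ch cs v
    obtain ⟨L, -, hL⟩ := exists_pos hk hf hu hu'
    exact ⟨_, hL v hv⟩
  choose P hP using hex
  rw [h.unique (hP v), h'.unique (hP v')]
  have hloc : ∀ x, ∀ᶠ y in 𝓝 x, ‖P y - P x‖ = ‖y - x‖ := by
    intro x
    filter_upwards [eventually_common_Ch cs x] with y hy
    obtain ⟨u', hu', hx, hy⟩ := hy
    obtain ⟨L, -, hL⟩ := exists_pos hk hf hu hu'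
    rw [(hP x).unique (hL x hx), (hP y).unique (hL y hy), ← map_sub, L.norm_map]
  have hcP : Continuous P := by
    rw [continuous_iff_continuousAt]
    intro x
    rw [ContinuousAt, tendsto_iff_norm_sub_tendsto_zero]
    refine Tendsto.congr' (f₁ := fun y => ‖y - x‖) ?_ ?_
    · filter_upwards [hloc x] with y hy using hy.symm
    · have : Continuous fun y : ModelSpace n => ‖y - x‖ := by fun_prop
      simpa using this.tendsto x
  set γ : ℝ → ModelSpace n := fun s => v + s • (v' - v) with hγ
  have hγc : Continuous γ := by fun_prop
  have hsub : Icc (0 : ℝ) 1 ⊆ {s | ‖P (γ s) - P v‖ ≤ s * ‖v' - v‖} := by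
    refine IsClosed.Icc_subset_of_forall_exists_gt ?_ ?_ ?_
    · refine IsClosed.inter (isClosed_le ?_ ?_) isClosed_Icc
      · exact ((hcP.comp hγc).sub continuous_const).norm
      · fun_prop
    · simp [hγ]
    · rintro s ⟨hs, -⟩ y hy
      have h1 : ∀ᶠ s' in 𝓝[>] s, ‖P (γ s') - P (γ s)‖ = ‖γ s' - γ s‖ :=
        ((hγc.tendsto s).mono_left nhdsWithin_le_nhds).eventually (hloc (γ s))
      obtain ⟨s', hs', hm⟩ := (h1.and (Ioc_mem_nhdsGT hy)).exists
      refine ⟨s', ?_, hm⟩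
      rw [mem_ofPred_eq] at hs ⊢
      have h2 : ‖γ s' - γ s‖ = (s' - s) * ‖v' - v‖ := by
        rw [show γ s' - γ s = (s' - s) • (v' - v) by simp only [hγ]; module, norm_smul,
          Real.norm_of_nonneg (by linarith [hm.1])]
      have h3 := norm_sub_le_norm_sub_add_norm_sub (P (γ s')) (P (γ s)) (P v)
      rw [hs', h2] at h3
      linarith
  have := hsub (right_mem_Icc.2 zero_le_one)
  simp only [mem_ofPred_eq, hγ, one_smul, one_mul, add_sub_cancel] at this
  rwa [norm_sub_rev, norm_sub_rev v]

/-- A chart standing correctly on two opposite chambers stands correctly everywhere. -/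
theorem pos_of_opposite {k f : ModelSpace n → X} (hk : k ∈ B.charts) (hf : f ∈ B.charts)
    {u e : ModelSpace n} (hu : cs.Reg u)
    (h1 : ∀ v ∈ cs.Ch e, Pos cs k u (rayOf f v) v)
    (h2 : ∀ v ∈ cs.Ch e, Pos cs k u (rayOf f (-v)) (-v)) (v : ModelSpace n) :
    Pos cs k u (rayOf f v) v := by
  obtain ⟨u', hu', hv⟩ := exists_reg_mem_Ch cs v
  obtain ⟨L, -, hL⟩ := exists_pos hk hf hu hu'
  have hLv := hL v hv
  have hn : ‖L v‖ = ‖v‖ := L.norm_map v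
  have : L v - v = 0 := by
    refine eq_zero_of_perp_Ch (cs := cs) (u := e) fun x hx => ?_
    have e1 := pow_le_pow_left₀ (norm_nonneg _) (norm_pos_sub_le hk hf hu hLv (h1 x hx)) 2
    have e2 := pow_le_pow_left₀ (norm_nonneg _) (norm_pos_sub_le hk hf hu hLv (h2 x hx)) 2
    simp only [norm_sub_sq_real, hn, inner_neg_right, norm_neg] at e1 e2
    rw [inner_sub_left]
    linarith
  rwa [sub_eq_zero.1 this] at hLv

theorem exists_shift_of_pos {k f : ModelSpace n → X} (hk : k ∈ B.charts) (hf : f ∈ B.charts)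
    {u : ModelSpace n} (hu : cs.Reg u) (h : ∀ v ∈ cs.Ch u, Pos cs k u (rayOf f v) v) :
    ∃ c, Asym cs (fun x => f (x + c)) k u := by
  obtain ⟨m, hm, h1, L, hL, c, h2⟩ := exists_common_chart hk hf hu hu
  have hL1 := eq_id_of_eqOn_Ch (cs := cs) (u := u) one_pos L fun v hv _ =>
    ((pos_of_asym hk hm h1.symm (L v)).congr
    ((near_reparam hm L c v).symm.trans (near_of_asym (B.chart_comp hm hL c) hf h2 hv))).unique
      (h v hv)
  have h3 := h2.shift (-c)
  simp only [hL1, neg_add_cancel_right] at h3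
  exact ⟨-c, h3.symm.trans h1⟩

theorem asym_of_pos {k f : ModelSpace n → X} (hk : k ∈ B.charts) (hf : f ∈ B.charts)
    {u : ModelSpace n} (hu : cs.Reg u) (h : ∀ v ∈ cs.Ch u, Pos cs k u (rayOf f v) v)
    (hc : Coherent f k) : Asym cs f k u := by
  obtain ⟨c, h1⟩ := exists_shift_of_pos hk hf hu h
  exact hc.asym_of_shift h1

/-- Given two charts agreeing on a chamber at infinity, there is a third one agreeing with the
first on a half-apartment and with the second on the adjacent chamber. -/
theorem exists_bridge {k f : ModelSpace n → X} (hk : k ∈ B.charts) (hf : f ∈ B.charts)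
    {u a p : ModelSpace n} (hw : cs.Wall u a p) (h : Asym cs k f u) :
    ∃ m ∈ B.charts, Asym cs m k u ∧ Asym cs m k (-reflAlong a u) ∧ Asym cs m f (reflAlong a u) := by
  obtain ⟨m, hm, h1, L, hL, c, h2⟩ := exists_common_chart hk hf hw.reg_refl.neg hw.reg_refl
  have hnear : ∀ v ∈ cs.Ch (reflAlong a u), Near (rayOf f v) (rayOf m (L v)) := fun v hv =>
    (near_of_asym hf (B.chart_comp hm hL c) h2.symm hv).trans (near_reparam hm L c v)
  have hpanel := hw.eq_one_or_eq_refl L fun v hv hv' =>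
    ((pos_of_asym hk hm h1.symm (L v)).congr ((hnear v hv').symm.trans
      (near_of_asym hf hk h.symm hv))).unique (pos_of_asym hk hk Asym.rfl' v)
  rcases hpanel with hL1 | hLr
  · have hc1 := coherent_of_asym hm hk h1
    have hmk : Asym cs m k u := by
      refine asym_of_pos hk hm hw.reg (fun v _ => ?_) hc1
      refine pos_of_opposite hk hm (e := reflAlong a u) hw.reg (fun v hv => ?_) (fun v hv => ?_) v
      · have := hnear v hv
        rw [hL1] at this
        exact (pos_of_asym hk hf h v).congr this
      · refine (pos_of_asym hk hk Asym.rfl' (-v)).congr (near_of_asym hk hm h1.symm ?_)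
        rwa [mem_Ch_neg, neg_neg]
    refine ⟨m, hm, hmk, h1, (coherent_of_asym hm hf (hmk.trans h)).asym_of_shift (c := c) ?_⟩
    simpa only [hL1] using h2
  · exfalso
    have e1 : Pos cs k u (rayOf m u) (reflAlong a u) := by
      have := hnear _ (self_mem_Ch _)
      rw [hLr, reflAlong_reflAlong] at this
      exact (pos_of_asym hk hf h _).congr this
    have e2 : Pos cs k u (rayOf m (-reflAlong a u)) (-reflAlong a u) :=
      (pos_of_asym hk hk Asym.rfl' _).congr (near_of_asym hk hm h1.symm (self_mem_Ch _))
    have e3 := pow_le_pow_left₀ (norm_nonneg _) (norm_pos_sub_le hk hm hw.reg e1 e2) 2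
    have h0 : 0 < (inner ℝ a u : ℝ) ^ 2 := by
      have := hw.reg a hw.root
      positivity
    have e4 : (inner ℝ u (reflAlong a u) : ℝ) = ‖u‖ ^ 2 - 2 * (inner ℝ a u) ^ 2 := by
      rw [reflAlong_apply (norm_of_mem_Roots hw.root), inner_sub_right, inner_smul_right,
        real_inner_self_eq_norm_sq, real_inner_comm u a]
      ring
    simp only [norm_sub_sq_real, inner_neg_right, norm_neg, LinearIsometryEquiv.norm_map,
      LinearIsometryEquiv.inner_map_map, real_inner_self_eq_norm_sq, e4] at e3
    linarith

/-- Two charts agreeing on a chamber but not on an adjacent one see these adjacent chambers as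
reflections of each other. -/
theorem exists_refl_of_not_asym {k f : ModelSpace n → X} (hk : k ∈ B.charts) (hf : f ∈ B.charts)
    {u a p : ModelSpace n} (hw : cs.Wall u a p) (h : Asym cs k f u)
    (hn : ¬ Asym cs k f (reflAlong a u)) :
    ∃ m ∈ B.charts, Asym cs m k (reflAlong a u) ∧
      ∃ c, Asym cs (fun x => m (reflAlong a x + c)) f (reflAlong a u) := by
  obtain ⟨m, hm, h1, L, hL, c, h2⟩ := exists_common_chart hk hf hw.reg_refl hw.reg_refl
  have hnear : ∀ v ∈ cs.Ch (reflAlong a u), Near (rayOf f v) (rayOf m (L v)) := fun v hv =>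
    (near_of_asym hf (B.chart_comp hm hL c) h2.symm hv).trans (near_reparam hm L c v)
  have hpanel := hw.eq_one_or_eq_refl L fun v hv hv' =>
    ((pos_of_asym hk hm h1.symm (L v)).congr ((hnear v hv').symm.trans
      (near_of_asym hf hk h.symm hv))).unique (pos_of_asym hk hk Asym.rfl' v)
  rcases hpanel with hL1 | hLr
  · exfalso
    apply hn
    simp only [hL1] at h2
    exact (coherent_of_asym hk hf h).asym_of_shift ((h1.symm.shift c).trans h2)
  · refine ⟨m, hm, h1, c, ?_⟩
    simpa only [hLr] using h2

end RBuilding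

end Rays

section Exchange

open SphericalCoxeterSystem Filter Topology

variable {n : ℕ} {cs : SphericalCoxeterSystem n} {X : Type*} [MetricSpace X] {Λ : Set X}

namespace SphericalCoxeterSystem

theorem reflAlong_neg (a : ModelSpace n) : reflAlong (-a) = reflAlong a := by
  unfold reflAlong
  congr 2
  rw [← Submodule.span_neg]
  simp

theorem Wall.neg_root {u a p : ModelSpace n} (h : cs.Wall u a p) : cs.Wall u (-a) p :=
  ⟨h.reg, Roots_neg h.root, by rw [inner_neg_left, h.inner_eq, neg_zero], fun b hb h1 h2 =>
    h.pos b hb (by rwa [neg_neg] at h2) h1⟩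

end SphericalCoxeterSystem

namespace RBuilding

variable {B : RBuilding cs X Λ}

theorem isHalfApartment_of_agree {f g : ModelSpace n → X} (hf : f ∈ B.charts)
    (hc : Coherent f g) {a : ModelSpace n} (ha : a ∈ cs.Roots) {c : ℝ}
    (h : {x | f x = g x} = {x | c ≤ inner ℝ a x}) :
    IsHalfApartment cs B.charts (range f ∩ range g) := by
  refine ⟨f, hf, _, _, isModelHalf_halfSpace ha c, ?_⟩
  rw [← h, hc.setOf_eq]
  ext q
  constructor
  · rintro ⟨⟨x, rfl⟩, hx⟩
    exact ⟨x, hx, rfl⟩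
  · rintro ⟨x, hx, rfl⟩
    exact ⟨⟨x, rfl⟩, hx⟩

theorem half_agree {f g : ModelSpace n → X} (hf : f ∈ B.charts) (hg : g ∈ B.charts)
    {u a p : ModelSpace n} (hw : cs.Wall u a p) (h0 : (0 : ℝ) < inner ℝ a u)
    (h1 : Asym cs f g u) (h2 : Asym cs f g (-reflAlong a u)) :
    {x | f x = g x} = univ ∨ ∃ c : ℝ, {x | f x = g x} = {x | c ≤ inner ℝ a x} := by
  have hc := coherent_of_asym hf hg h1
  obtain ⟨z₁, hz₁⟩ := h1
  obtain ⟨z₂, hz₂⟩ := h2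
  exact hw.eq_univ_or_halfSpace (isClosed_agree hf hg hc) (convex_agree hf hg hc) h0 hz₁ hz₂

/-- An apartment sharing a chamber at infinity with `f` is covered by two apartments sharing the
adjacent chamber with `f`, along half-apartments. -/
theorem exists_half_covers {k f : ModelSpace n → X} (hk : k ∈ B.charts) (hf : f ∈ B.charts)
    {u a p : ModelSpace n} (hw : cs.Wall u a p) (h0 : (0 : ℝ) < inner ℝ a u) (h : Asym cs k f u)
    (hn : ¬ Asym cs k f (reflAlong a u)) :
    ∃ g₁ ∈ B.charts, ∃ g₂ ∈ B.charts, Asym cs g₁ f (reflAlong a u) ∧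
      Asym cs g₂ f (reflAlong a u) ∧ ∃ c : ℝ, (∀ x, c ≤ inner ℝ a x → k x ∈ range g₁) ∧
        ∀ x, inner ℝ a x ≤ c → k x ∈ range g₂ := by
  have hra := inner_reflAlong (norm_of_mem_Roots hw.root)
  obtain ⟨g, hg, hgk, hgk', hgf⟩ := exists_bridge hk hf hw h
  have hkg : ¬ Asym cs k g (reflAlong a u) := fun h' => hn (h'.trans hgf)
  obtain ⟨c₁, hc₁⟩ : ∃ c : ℝ, {x | k x = g x} = {x | c ≤ inner ℝ a x} := by
    refine (half_agree hk hg hw h0 hgk.symm hgk'.symm).resolve_left fun hu => hkg ⟨0, fun v _ => ?_⟩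
    exact (eq_univ_iff_forall.1 hu _ :)
  have hkgc := coherent_of_asym hk hg hgk.symm
  -- the chart obtained by reflecting an apartment on the other side of the wall
  obtain ⟨m, hm, hmk, c, hmc⟩ := exists_refl_of_not_asym hk hg hw.refl.neg hgk'.symm (by
    rw [map_neg, reflAlong_reflAlong]
    exact not_asym_of_half hc₁ (by rw [inner_neg_right]; linarith))
  rw [map_neg, reflAlong_reflAlong] at hmk hmc
  obtain ⟨q, hq, hqk, hqk', hqm⟩ := exists_bridge hk hm hw.neg hmk.symm
  rw [map_neg, neg_neg] at hqk'
  rw [map_neg] at hqm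
  set q' : ModelSpace n → X := fun x => q (reflAlong a x + c) with hq'def
  have hq' : q' ∈ B.charts := B.chart_comp hq hw.refl_mem c
  have hrange : range q' = range q := by
    apply Subset.antisymm
    · rintro _ ⟨x, rfl⟩; exact ⟨_, rfl⟩
    · rintro _ ⟨x, rfl⟩
      refine ⟨reflAlong a (x - c), ?_⟩
      rw [hq'def]
      beta_reduce
      rw [reflAlong_reflAlong, sub_add_cancel]
  have hq'g : Asym cs q' g (-u) := by
    have : Asym cs q m (reflAlong a (-u)) := by rwa [map_neg]
    exact (this.reparam hw.refl_mem c).trans hmc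
  have hq'gc := coherent_of_asym hq' hg hq'g
  have hqg : Asym cs q' g (reflAlong a u) := by
    obtain ⟨m₂, hm₂, hm₂k, c₂, hm₂g⟩ := exists_refl_of_not_asym hk hg hw hgk.symm hkg
    have hposk : ∀ y ∈ cs.Ch (reflAlong a u),
        Pos cs g (reflAlong a u) (rayOf k y) (reflAlong a y) := by
      intro y hy
      have h1 := near_reparam hm₂ (reflAlong a) c₂ (reflAlong a y)
      rw [reflAlong_reflAlong] at h1
      exact (pos_of_asym hg (B.chart_comp hm₂ hw.refl_mem c₂) hm₂g.symm _).congr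
        (h1.trans (near_of_asym hm₂ hk hm₂k hy))
    refine asym_of_pos hg hq' hw.reg_refl (fun v _ => ?_) hq'gc
    refine pos_of_opposite hg hq' (e := u) hw.reg_refl (fun v hv => ?_) (fun v hv => ?_) v
    · have h1 := hposk _ (map_mem_Ch hw.refl_mem hv)
      rw [reflAlong_reflAlong] at h1
      exact h1.congr ((near_of_asym hk hq hqk'.symm (map_mem_Ch hw.refl_mem hv)).trans
        (near_reparam hq (reflAlong a) c v).symm)
    · refine (pos_of_asym hg hg Asym.rfl' (-v)).congr (near_of_asym hg hq' hq'g.symm ?_)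
      rwa [mem_Ch_neg, neg_neg]
  -- a common point of the two half-apartments
  have hw' := hw.refl.neg_root
  have h0' : (0 : ℝ) < inner ℝ (-a) (reflAlong a u) := by rw [inner_neg_left, hra]; linarith
  have hrr : reflAlong (-a) (reflAlong a u) = u := by rw [reflAlong_neg, reflAlong_reflAlong]
  have hkqc := coherent_of_asym hk hq hqk.symm
  obtain ⟨x₀, hx₀, hx₀'⟩ : ∃ x₀, k x₀ = g x₀ ∧ k x₀ = q x₀ := by
    rcases half_agree hk hq hw' h0' hqk'.symm (by rw [hrr]; exact hqk.symm) with hu | ⟨c₂, hc₂⟩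
    · obtain ⟨z, hz⟩ := hgk
      exact ⟨z + 0, (hz 0 (zero_mem_Ch u)).symm, (eq_univ_iff_forall.1 hu _ :)⟩
    rcases half_agree hg hq' hw' h0' hqg.symm (by rw [hrr]; exact hq'g.symm) with hu | ⟨c₃, hc₃⟩
    · exfalso
      obtain ⟨z, hz⟩ := hqk'
      refine hkg ⟨z, fun v hv => hkgc _ ?_⟩
      rw [← hz v hv]
      have hgq : g = q' := funext fun x => (eq_univ_iff_forall.1 hu x :)
      rw [hgq, hrange]
      exact ⟨_, rfl⟩
    · have H := B.A5 g hg k hk q hq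
        (by rw [inter_comm]; exact isHalfApartment_of_agree hk hkgc hw.root hc₁)
        (isHalfApartment_of_agree hk hkqc hw'.root hc₂)
        (by rw [← hrange]; exact isHalfApartment_of_agree hg
              (coherent_of_asym hg hq' hq'g.symm) hw'.root hc₃)
      obtain ⟨_, ⟨h1, x, rfl⟩, h2⟩ := H
      exact ⟨x, hkgc x h1, hkqc x h2⟩
  have hx₀c : c₁ ≤ inner ℝ a x₀ := by
    have : x₀ ∈ {x | k x = g x} := hx₀
    rwa [hc₁] at this
  refine ⟨g, hg, q', hq', hgf, hqg.trans hgf, c₁, fun x hx => ?_, fun x hx => ?_⟩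
  · have : x ∈ {x | k x = g x} := by rw [hc₁]; exact hx
    exact ⟨x, Eq.symm this⟩
  · obtain ⟨z₁, hz₁⟩ := hqk'
    obtain ⟨z₂, hz₂⟩ := hqk
    have : x ∈ {x | k x = q x} := hw'.upward_closed (isClosed_agree hk hq hkqc)
      (convex_agree hk hq hkqc) h0' (fun w hw => (hz₁ w hw).symm)
      (z₂ := z₂) (by rw [hrr]; exact fun w hw => (hz₂ w hw).symm) hx₀'
      (by rw [inner_neg_left, inner_neg_left]; linarith)
    rw [hrange]
    exact ⟨x, Eq.symm this⟩

theorem exists_cover_germ_adjacent {k f : ModelSpace n → X} (hk : k ∈ B.charts)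
    (hf : f ∈ B.charts) {u a p : ModelSpace n} (hw : cs.Wall u a p)
    (h0 : (0 : ℝ) < inner ℝ a u) (h : Asym cs k f u) (x₀ : ModelSpace n) {e : ModelSpace n}
    (he : cs.Reg e) :
    ∃ k' ∈ B.charts, Asym cs k' f (reflAlong a u) ∧
      ∃ ε : ℝ, 0 < ε ∧ ∀ v ∈ cs.Ch e, ‖v‖ < ε → k (x₀ + v) ∈ range k' := by
  by_cases hn : Asym cs k f (reflAlong a u)
  · exact ⟨k, hk, hn, 1, one_pos, fun v _ _ => ⟨_, rfl⟩⟩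
  obtain ⟨g₁, hg₁, g₂, hg₂, h1, h2, c, hc₁, hc₂⟩ := exists_half_covers hk hf hw h0 h hn
  have hin : ∀ v : ModelSpace n, |(inner ℝ a v : ℝ)| ≤ ‖v‖ := abs_inner_root_le hw.root
  rcases lt_trichotomy (inner ℝ a x₀ : ℝ) c with hx | hx | hx
  · refine ⟨g₂, hg₂, h2, c - inner ℝ a x₀, by linarith, fun v _ hvε => hc₂ _ ?_⟩
    rw [inner_add_right]
    linarith [le_abs_self (inner ℝ a v : ℝ), hin v]
  · rcases lt_or_gt_of_ne (he a hw.root) with hs | hs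
    · refine ⟨g₂, hg₂, h2, 1, one_pos, fun v hv _ => hc₂ _ ?_⟩
      have := hv _ (Roots_neg hw.root) (by rw [inner_neg_left]; linarith)
      rw [inner_neg_left] at this
      rw [inner_add_right]
      linarith
    · refine ⟨g₁, hg₁, h1, 1, one_pos, fun v hv _ => hc₁ _ ?_⟩
      have := hv _ hw.root hs
      rw [inner_add_right]
      linarith
  · refine ⟨g₁, hg₁, h1, inner ℝ a x₀ - c, by linarith, fun v _ hvε => hc₁ _ ?_⟩
    rw [inner_add_right]
    linarith [neg_abs_le (inner ℝ a v : ℝ), hin v]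

theorem exists_cover_germ_of_asym {f : ModelSpace n → X} (hf : f ∈ B.charts) {u : ModelSpace n}
    (hu : cs.Reg u) (N : ℕ) : ∀ w, cs.Reg w → sepCount cs w u < N → ∀ k ∈ B.charts,
    Asym cs k f w → ∀ x₀ e, cs.Reg e → ∃ k' ∈ B.charts, Asym cs k' f u ∧
      ∃ ε : ℝ, 0 < ε ∧ ∀ v ∈ cs.Ch e, ‖v‖ < ε → k (x₀ + v) ∈ range k' := by
  induction N with
  | zero => intro w _ hw; exact absurd hw (Nat.not_lt_zero _)
  | succ N ih =>
    intro w hw hN k hk hkf x₀ e he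
    by_cases huw : u ∈ cs.Ch w
    · exact ⟨k, hk, hkf.congr_Ch (hw.Ch_eq_of_mem hu huw), 1, one_pos, fun v _ _ => ⟨_, rfl⟩⟩
    obtain ⟨a, p, hwall, h1, h2⟩ := exists_wall_separating hw huw
    obtain ⟨k₁, hk₁, hk₁f, ε, hε, hk₁r⟩ := exists_cover_germ_adjacent hk hf hwall h1 hkf x₀ he
    obtain ⟨L, hL, c, hLc⟩ := B.exists_transition hk hk₁
    have hlt := hwall.sepCount_lt h1 h2
    obtain ⟨k', hk', hk'f, ε', hε', hk'r⟩ :=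
      ih _ hwall.reg_refl (by omega) k₁ hk₁ hk₁f (L x₀ + c) (L e) (he.map hL)
    refine ⟨k', hk', hk'f, min ε ε', lt_min hε hε', fun v hv hvε => ?_⟩
    rw [hLc _ (hk₁r v hv (hvε.trans_le (min_le_left _ _))), map_add, add_right_comm]
    exact hk'r _ (map_mem_Ch hL hv) (by
      rw [L.norm_map]; exact hvε.trans_le (min_le_right _ _))

/-- Every germ of a sector and every chamber at infinity lie in a common apartment. -/
theorem exists_cover_germ {k f : ModelSpace n → X} (hk : k ∈ B.charts) (hf : f ∈ B.charts)
    (x₀ : ModelSpace n) {e u : ModelSpace n} (he : cs.Reg e) (hu : cs.Reg u) :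
    ∃ k' ∈ B.charts, Asym cs k' f u ∧
      ∃ ε : ℝ, 0 < ε ∧ ∀ v ∈ cs.Ch e, ‖v‖ < ε → k (x₀ + v) ∈ range k' := by
  obtain ⟨m, hm, hmf, L, hL, c, hmk⟩ := exists_common_chart hf hk hu hu
  have hLi : ∀ x, L (L⁻¹ x) = x := L.apply_symm_apply
  have hiL : ∀ x, L⁻¹ (L x) = x := L.symm_apply_apply
  have hk₁ := B.chart_comp hk (inv_mem hL) (-(L⁻¹ c))
  have h1 : Asym cs (fun x => k (L⁻¹ x + -(L⁻¹ c))) m (L u) := by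
    have : Asym cs (fun x => m (L x + c)) k (L⁻¹ (L u)) := by rwa [hiL]
    have := this.reparam (inv_mem hL) (-(L⁻¹ c))
    simp only [map_add, map_neg, hLi, neg_add_cancel_right] at this
    exact this.symm
  obtain ⟨k', hk', hk'm, ε, hε, hk'r⟩ := exists_cover_germ_of_asym hm hu _ (L u) (hu.map hL)
    (Nat.lt_succ_self _) _ hk₁ h1 (L x₀ + c) (L e) (he.map hL)
  refine ⟨k', hk', hk'm.trans hmf, ε, hε, fun v hv hvε => ?_⟩
  have := hk'r (L v) (map_mem_Ch hL hv) (by rwa [L.norm_map])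
  simp only [map_add, hiL] at this
  convert this using 2
  abel

end RBuilding

end Exchange

section Germs

open SphericalCoxeterSystem Filter Topology

variable {n : ℕ} {cs : SphericalCoxeterSystem n} {X : Type*} [MetricSpace X] {Λ : Set X}

theorem nonpos_of_forall_mul_le {c K : ℝ} (h : ∀ t : ℝ, 0 ≤ t → t * c ≤ K) : c ≤ 0 := by
  by_contra! hc
  have h1 := h ((|K| + 1) / c) (by positivity)
  rw [div_mul_cancel₀ _ hc.ne'] at h1
  have := le_abs_self K
  linarith

namespace SphericalCoxeterSystem

theorem Reg.add_smul {u v : ModelSpace n} (hu : cs.Reg u) (hv : v ∈ cs.Ch u) {δ : ℝ} (hδ : 0 < δ) :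
    cs.Reg (v + δ • u) := by
  have key : ∀ a ∈ cs.Roots, (0 : ℝ) < inner ℝ a u → (0 : ℝ) < inner ℝ a (v + δ • u) := by
    intro a ha hp
    rw [inner_add_right, inner_smul_right]
    exact add_pos_of_nonneg_of_pos (hv a ha hp) (mul_pos hδ hp)
  intro a ha
  rcases (hu a ha).lt_or_gt with h | h
  · have := key _ (Roots_neg ha) (by rw [inner_neg_left]; linarith)
    rw [inner_neg_left] at this
    exact (neg_pos.1 this).ne
  · exact (key a ha h).ne'

end SphericalCoxeterSystem

namespace RBuilding

variable {B : RBuilding cs X Λ}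

theorem inner_sub_le_of_asym {f g : ModelSpace n → X} (hf : f ∈ B.charts) (hg : g ∈ B.charts)
    {u x y y' : ModelSpace n} (h : Asym cs f g u) (hx : x ∈ cs.Ch u) :
    (inner ℝ (y' - y) x : ℝ) ≤ dist (f y) (g y') * ‖x‖ := by
  obtain ⟨z, hz⟩ := h
  set d := dist (f y) (g y') with hd
  set w := y' - y with hw
  refine sub_nonpos.1 (nonpos_of_forall_mul_le
    (K := d * ‖z - y'‖ + d ^ 2 / 2 - inner ℝ w (z - y')) fun t ht => ?_)
  have h1 : ‖z + t • x - y‖ ≤ d + ‖z + t • x - y'‖ := by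
    have h2 := dist_triangle (f y) (g y') (f (z + t • x))
    rw [hz _ (smul_mem_Ch ht hx), (B.isom g hg).dist_eq, ← hz _ (smul_mem_Ch ht hx),
      (B.isom f hf).dist_eq, dist_comm, dist_comm y', dist_eq_norm, dist_eq_norm] at h2
    exact h2
  have h2 := pow_le_pow_left₀ (norm_nonneg _) h1 2
  have h3 : ‖z + t • x - y'‖ ≤ ‖z - y'‖ + t * ‖x‖ := by
    rw [show z + t • x - y' = (z - y') + t • x by abel]
    refine (norm_add_le _ _).trans_eq ?_
    rw [norm_smul, Real.norm_of_nonneg ht]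
  rw [show z + t • x - y = w + (z + t • x - y') by rw [hw]; abel, norm_add_sq_real, add_sq] at h2
  have h4 : (inner ℝ w (z + t • x - y') : ℝ) = inner ℝ w (z - y') + t * inner ℝ w x := by
    rw [show z + t • x - y' = (z - y') + t • x by abel, inner_add_right, inner_smul_right]
  have h5 : d * ‖z + t • x - y'‖ ≤ d * (‖z - y'‖ + t * ‖x‖) :=
    mul_le_mul_of_nonneg_left h3 dist_nonneg
  have h6 := sq_nonneg ‖w‖
  rw [h4] at h2
  nlinarith

/-- Coordinates relative to a fixed chamber at infinity vary in a Lipschitz way. -/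
theorem exists_norm_sub_le (B : RBuilding cs X Λ) (u : ModelSpace n) :
    ∃ C : ℝ, 0 < C ∧ ∀ f ∈ B.charts, ∀ g ∈ B.charts, Asym cs f g u → ∀ y y',
      ‖y - y'‖ ≤ C * dist (f y) (g y') := by
  obtain ⟨C, hC, hCh⟩ := exists_smul_add_mem_Ch cs u
  refine ⟨2 * C * ‖u‖ + 1, by positivity, fun f hf g hg h y y' => ?_⟩
  set w := y - y' with hw
  have h1 := inner_sub_le_of_asym hg hf (y := y') (y' := y) h.symm (hCh w (C * ‖w‖) le_rfl)
  have h2 := inner_sub_le_of_asym hf hg (y := y) (y' := y') h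
    (smul_mem_Ch (by positivity : 0 ≤ C * ‖w‖) (self_mem_Ch u))
  rw [dist_comm, ← hw, inner_add_right, real_inner_self_eq_norm_sq] at h1
  rw [← neg_sub, ← hw, inner_neg_left] at h2
  have h3 : ‖(C * ‖w‖) • u‖ = C * ‖w‖ * ‖u‖ := by
    rw [norm_smul, Real.norm_of_nonneg (by positivity)]
  have h4 := norm_add_le ((C * ‖w‖) • u) w
  rw [h3] at h2 h4
  have h5 := mul_le_mul_of_nonneg_left h4 (dist_nonneg (x := f y) (y := g y'))
  rcases (norm_nonneg w).eq_or_lt with h0 | h0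
  · rw [← h0]; positivity
  · refine le_of_mul_le_mul_right ?_ h0
    nlinarith

theorem eq_on_translate {f g : ModelSpace n → X} (hf : f ∈ B.charts) (hg : g ∈ B.charts)
    {u y y' v : ModelSpace n} (h : Asym cs f g u) (hy : f y = g y') (hv : v ∈ cs.Ch u) :
    f (y + v) = g (y + v) := by
  have hc := coherent_of_asym hf hg h
  obtain ⟨z, hz⟩ := h
  exact add_mem_of_translate_subset (cs := cs) (isClosed_agree hf hg hc) (convex_agree hf hg hc)
    (x := y) (z := z) hz (hc y ⟨y', hy.symm⟩) hv

/-- Two parallel sectors share a subsector whose depth is controlled by the distance of their base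
points. -/
theorem exists_depth (B : RBuilding cs X Λ) {u : ModelSpace n} (hu : cs.Reg u) :
    ∃ M : ℝ, 0 < M ∧ ∀ f ∈ B.charts, ∀ h ∈ B.charts, Asym cs h f u → ∀ x y,
      (M * dist (f x) (h y)) • u + (x - y) ∈ cs.Ch u ∧
      ∀ v ∈ cs.Ch u, f (x + (M * dist (f x) (h y)) • u + v) =
        h (x + (M * dist (f x) (h y)) • u + v) := by
  obtain ⟨C, hC, hCh⟩ := exists_smul_add_mem_Ch cs u
  obtain ⟨D, hD, hDn⟩ := exists_norm_sub_le B u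
  refine ⟨C * D, by positivity, fun f hf h hh hhf x y => ?_⟩
  set d := dist (f x) (h y) with hd
  have hdeep : ∀ g ∈ B.charts, Asym cs g f u → ∀ y', dist (f x) (g y') ≤ d →
      (C * D * d) • u + (x - y') ∈ cs.Ch u := by
    intro g hg hgf y' hy'
    refine hCh _ _ ?_
    rw [mul_assoc]
    refine mul_le_mul_of_nonneg_left ((hDn f hf g hg hgf.symm x y').trans ?_) hC.le
    exact mul_le_mul_of_nonneg_left hy' hD.le
  refine ⟨hdeep h hh hhf y le_rfl, fun v hv => ?_⟩
  set z := x + (C * D * d) • u + v with hz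
  have hull : ∀ g ∈ B.charts, ∀ g' ∈ B.charts, Asym cs g f u → Asym cs g' f u → ∀ p,
      dist (f x) p ≤ d → p ∈ range g → p ∈ range g' → g z = g' z := by
    rintro g hg g' hg' hgf hgf' p hp ⟨y₁, rfl⟩ ⟨y₂, hy₂⟩
    have := eq_on_translate hg hg' (hgf.trans hgf'.symm) hy₂.symm
      (add_mem_Ch (hdeep g hg hgf y₁ hp) hv)
    rwa [show y₁ + ((C * D * d) • u + (x - y₁) + v) = z by rw [hz]; abel] at this
  obtain ⟨k, hk, ⟨a, ha⟩, b, hb⟩ := B.A3 (f x) (B.into f hf ⟨x, rfl⟩) (h y) (B.into h hh ⟨y, rfl⟩)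
  set q : ℝ → ModelSpace n := fun t => a + t • (b - a) with hq
  have hdab : d = ‖b - a‖ := by
    rw [hd, ← ha, ← hb, (B.isom k hk).dist_eq, dist_comm, dist_eq_norm]
  have hqd : ∀ t ∈ Icc (0 : ℝ) 1, dist (f x) (k (q t)) ≤ d := by
    intro t ht
    rw [← ha, (B.isom k hk).dist_eq, dist_comm, dist_eq_norm, hq, add_sub_cancel_left, norm_smul,
      Real.norm_of_nonneg ht.1, hdab]
    exact mul_le_of_le_one_left (norm_nonneg _) ht.2
  obtain ⟨e, he, hbe⟩ := exists_reg_mem_Ch cs (b - a)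
  have key : ∀ g ∈ B.charts, ∀ g' ∈ B.charts, Asym cs g f u → Asym cs g' f u →
      k (q 0) ∈ range g → k (q 1) ∈ range g' → g z = g' z := by
    refine isPreconnected_Icc.induction₂ (s := Icc (0 : ℝ) 1) (fun s t => ∀ g ∈ B.charts,
      ∀ g' ∈ B.charts, Asym cs g f u → Asym cs g' f u → k (q s) ∈ range g → k (q t) ∈ range g' →
      g z = g' z) ?_ ?_ ?_ (left_mem_Icc.2 zero_le_one) (right_mem_Icc.2 zero_le_one)
    · intro s hs
      obtain ⟨k₁, hk₁, hkf₁, ε₁, hε₁, h₁⟩ := exists_cover_germ hk hf (q s) he hu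
      obtain ⟨k₂, hk₂, hkf₂, ε₂, hε₂, h₂⟩ := exists_cover_germ hk hf (q s) he.neg hu
      have hcont : Continuous fun t : ℝ => (t - s) • (b - a) := by fun_prop
      have h0 : ∀ᶠ t in 𝓝 s, ‖(t - s) • (b - a)‖ < min ε₁ ε₂ := by
        refine hcont.norm.continuousAt.eventually_lt continuousAt_const ?_
        simpa using ⟨hε₁, hε₂⟩
      filter_upwards [mem_nhdsWithin_of_mem_nhds h0, self_mem_nhdsWithin] with t ht htI
      intro g hg g' hg' hgf hgf' hs' ht'
      have hqt : q t = q s + (t - s) • (b - a) := by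
        simp only [hq, sub_smul]; abel
      have hst : ∃ k' ∈ B.charts, Asym cs k' f u ∧ k (q s) ∈ range k' ∧ k (q t) ∈ range k' := by
        rcases le_total s t with hle | hle
        · refine ⟨k₁, hk₁, hkf₁, ?_, ?_⟩
          · simpa using h₁ 0 (zero_mem_Ch e) (by simpa using hε₁)
          · rw [hqt]
            exact h₁ _ (smul_mem_Ch (sub_nonneg.2 hle) hbe) (lt_of_lt_of_le ht (min_le_left _ _))
        · refine ⟨k₂, hk₂, hkf₂, ?_, ?_⟩
          · simpa using h₂ 0 (zero_mem_Ch _) (by simpa using hε₂)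
          · rw [hqt]
            refine h₂ _ (mem_Ch_neg.2 ?_) (lt_of_lt_of_le ht (min_le_right _ _))
            rw [← neg_smul, neg_sub]
            exact smul_mem_Ch (sub_nonneg.2 hle) hbe
      obtain ⟨k', hk', hkf', hks, hkt⟩ := hst
      exact (hull g hg k' hk' hgf hkf' _ (hqd s hs) hs' hks).trans
        (hull k' hk' g' hg' hkf' hgf' _ (hqd t htI) hkt ht')
    · intro r s t _ hs _ hrs hst g hg g' hg' hgf hgf' hr ht
      obtain ⟨k', hk', hkf', ε, hε, h'⟩ := exists_cover_germ hk hf (q s) he hu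
      have hks : k (q s) ∈ range k' := by simpa using h' 0 (zero_mem_Ch e) (by simpa using hε)
      exact (hrs g hg k' hk' hgf hkf' hr hks).trans (hst k' hk' g' hg' hkf' hgf' hks ht)
    · intro s t _ _ hst g hg g' hg' hgf hgf' hs ht
      exact (hst g' hg' g hg hgf' hgf ht hs).symm
  refine key f hf h hh Asym.rfl' hhf ⟨x, ?_⟩ ⟨y, ?_⟩
  · simp [hq, ha]
  · simp [hq, hb]

/-- Two sectors with the same base point, whose interiors share a germ, locally coincide. -/
theorem eq_germ_of_eq_interior {h₁ h₂ : ModelSpace n → X} (hh₁ : h₁ ∈ B.charts)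
    (hh₂ : h₂ ∈ B.charts) {u y : ModelSpace n} (hu : cs.Reg u) (hy : h₁ y = h₂ y) {ε : ℝ}
    (hε : 0 < ε) (h : ∀ w ∈ cs.Ch u, ‖w‖ < ε → h₁ (y + u + w) = h₂ (y + u + w)) :
    ∃ ε' : ℝ, 0 < ε' ∧ ∀ v ∈ cs.Ch u, ‖v‖ < ε' → h₁ (y + v) = h₂ (y + v) := by
  have hc := coherent_of_germ hh₁ hh₂ hε h
  obtain ⟨k, hk, hkh, ε₁, hε₁, hr⟩ := exists_cover_germ hh₂ hh₁ y hu hu.neg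
  have hck := coherent_of_asym hh₁ hk hkh.symm
  obtain ⟨z, hz⟩ := hkh
  have hcl := isClosed_agree hh₁ hk hck
  have hcv := convex_agree hh₁ hk hck
  have hyk : h₁ y = k y := hck y (by
    rw [hy]; simpa using hr 0 (zero_mem_Ch u) (by simpa using hε₁))
  have hback : ∀ v ∈ cs.Ch (-u), h₁ (y + v) = k (y + v) := fun v hv =>
    add_mem_of_translate_subset (cs := cs) hcl hcv (x := y) (z := z)
      (fun w hw => (hz w hw).symm) hyk hv
  obtain ⟨s, hs0, hs1, hs⟩ : ∃ s : ℝ, 0 < s ∧ s ≤ 1 ∧ s * (‖u‖ + ε) < ε₁ := by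
    have hp : 0 < ‖u‖ + ε := by positivity
    refine ⟨min 1 (ε₁ / 2 / (‖u‖ + ε)), by positivity, min_le_left _ _, ?_⟩
    have := mul_le_mul_of_nonneg_right (min_le_right 1 (ε₁ / 2 / (‖u‖ + ε))) hp.le
    rw [div_mul_cancel₀ _ hp.ne'] at this
    linarith
  have hseg : ∀ w ∈ cs.Ch u, ‖w‖ < ε → h₁ (y + s • (u + w)) = h₂ (y + s • (u + w)) ∧
      h₁ (y + s • (u + w)) = k (y + s • (u + w)) := by
    intro w hw hwε
    have h1 : h₁ (y + s • (u + w)) = h₂ (y + s • (u + w)) := by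
      have := (convex_agree hh₁ hh₂ hc).add_smul_mem (x := y) (y := u + w) hy
        (by rw [mem_ofPred_eq, ← add_assoc]; exact h w hw hwε) ⟨hs0.le, hs1⟩
      exact this
    refine ⟨h1, hck _ ?_⟩
    rw [h1]
    refine hr _ (smul_mem_Ch hs0.le (add_mem_Ch (self_mem_Ch u) hw)) ?_
    rw [norm_smul, Real.norm_of_nonneg hs0.le]
    refine lt_of_le_of_lt (mul_le_mul_of_nonneg_left ?_ hs0.le) hs
    exact (norm_add_le _ _).trans (by linarith)
  have hc₂ : Coherent h₂ k := by
    refine coherent_of_germ hh₂ hk (z := y + s • u) (e := u) (mul_pos hs0 hε) fun w hw hwε => ?_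
    have h1 := hseg (s⁻¹ • w) (smul_mem_Ch (inv_nonneg.2 hs0.le) hw) (by
      rw [norm_smul, norm_inv, Real.norm_of_nonneg hs0.le, inv_mul_lt_iff₀ hs0]
      exact hwε)
    rw [smul_add, smul_inv_smul₀ hs0.ne', ← add_assoc] at h1
    exact h1.1.symm.trans h1.2
  obtain ⟨C, hC, hCh⟩ := exists_smul_add_mem_Ch cs u
  refine ⟨min ε₁ (s / (2 * C)), by positivity, fun v hv hvε => ?_⟩
  have hvk : h₁ (y + v) = k (y + v) := by
    have h1 : y + s • u ∈ {x | h₁ x = k x} := by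
      simpa using (hseg 0 (zero_mem_Ch u) (by simpa using hε)).2
    have h2 : y + ((2 : ℝ) • v - s • u) ∈ {x | h₁ x = k x} := by
      refine hback _ (mem_Ch_neg.2 ?_)
      rw [neg_sub, sub_eq_add_neg]
      refine hCh _ _ ?_
      have := lt_of_lt_of_le hvε (min_le_right _ _)
      rw [lt_div_iff₀ (by positivity)] at this
      rw [norm_neg, norm_smul, Real.norm_ofNat]
      linarith
    have h3 := hcv h1 h2 (a := 1 / 2) (b := 1 / 2) (by norm_num) (by norm_num) (by norm_num)
    rw [show ((1 / 2 : ℝ) • (y + s • u) + (1 / 2 : ℝ) • (y + ((2 : ℝ) • v - s • u))) = y + v by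
      module] at h3
    exact h3
  rw [hvk, hc₂ _ (hr v hv (lt_of_lt_of_le hvε (min_le_left _ _)))]

end RBuilding

end Germs

section Align

open SphericalCoxeterSystem Filter Topology

variable {n : ℕ} {cs : SphericalCoxeterSystem n} {X : Type*} [MetricSpace X] {Λ : Set X}

theorem Par.symm {S T : Set X} (h : Par S T) : Par T S :=
  fun e => h (Metric.hausdorffEDist_comm.trans e)

theorem Par.trans {S T U : Set X} (h : Par S T) (h' : Par T U) : Par S U :=
  ne_top_of_le_ne_top (ENNReal.add_ne_top.2 ⟨h, h'⟩) Metric.hausdorffEDist_triangle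

namespace RBuilding

variable {B : RBuilding cs X Λ}

theorem exists_chart_of_isSectorAt {α : X} {T : Set X} (hT : IsSectorAt cs B.charts α T) :
    ∃ f ∈ B.charts, ∃ x u, cs.Reg u ∧ f x = α ∧ T = f '' {y | y - x ∈ cs.Ch u} := by
  obtain ⟨f, hf, x, s, hs, hx, rfl⟩ := hT
  obtain ⟨u, hu, rfl⟩ := hs.exists_reg
  exact ⟨f, hf, x, u, hu, hx, rfl⟩

/-- The position of a parallel sector lies in the chamber itself. -/
theorem mem_Ch_of_par {f h : ModelSpace n → X} (hf : f ∈ B.charts) (hh : h ∈ B.charts)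
    {u v a x y : ModelSpace n} {T : Set X} (hT : ∀ t : ℝ, 0 ≤ t → h (y + t • v) ∈ T)
    (hpar : Par T (f '' {z | z - x ∈ cs.Ch u})) (ha : Pos cs f u (rayOf h v) a) :
    a ∈ cs.Ch u := by
  obtain ⟨K, hK⟩ : ∃ K, ∀ t : ℝ, 0 ≤ t → ∃ w ∈ cs.Ch u, dist (rayOf h v t) (f w) ≤ K := by
    set r := (Metric.hausdorffDist T (f '' {z | z - x ∈ cs.Ch u})) + 1
    refine ⟨‖y‖ + r + ‖x‖, fun t ht => ?_⟩
    obtain ⟨q, ⟨z, hz, rfl⟩, hq⟩ := Metric.exists_dist_lt_of_hausdorffDist_lt (r := r) (hT t ht)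
      (lt_add_one _) hpar
    refine ⟨z - x, hz, ?_⟩
    have h1 : dist (rayOf h v t) (h (y + t • v)) = ‖y‖ := by
      rw [rayOf, (B.isom h hh).dist_eq, dist_eq_norm]; simp
    have h2 : dist (f z) (f (z - x)) = ‖x‖ := by
      rw [(B.isom f hf).dist_eq, dist_eq_norm]; simp
    linarith [dist_triangle4 (rayOf h v t) (h (y + t • v)) (f z) (f (z - x))]
  choose! w hw hwK using hK
  have hconv : ∀ z ∈ cs.Ch u, Tendsto (fun t : ℝ => ‖t⁻¹ • w t - z‖) atTop (𝓝 ‖a - z‖) := by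
    intro z hz
    have h1 : ∀ t : ℝ, 0 ≤ t →
        |dist (rayOf h v t) (f (t • z)) - dist (f (w t)) (f (t • z))| ≤ K :=
      fun t ht => (abs_dist_sub_le _ _ _).trans (hwK t ht)
    refine (tendsto_div_of_abs_sub_le h1 (ha z hz)).congr' ?_
    filter_upwards [eventually_gt_atTop 0] with t ht
    rw [(B.isom f hf).dist_eq, dist_eq_norm, div_eq_inv_mul, ← norm_smul_of_nonneg
      (inv_nonneg.2 ht.le), smul_sub, inv_smul_smul₀ ht.ne']
  have hb : ∃ᶠ t : ℝ in atTop,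
      t⁻¹ • w t ∈ Metric.closedBall (0 : ModelSpace n) (‖a‖ + 1) ∩ cs.Ch u := by
    refine Eventually.frequently ?_
    have h0 := hconv 0 (zero_mem_Ch u)
    simp only [sub_zero] at h0
    filter_upwards [h0.eventually (Iio_mem_nhds (lt_add_one _)), eventually_gt_atTop 0] with t h1 h2
    exact ⟨by simpa using le_of_lt h1, smul_mem_Ch (inv_nonneg.2 h2.le) (hw t h2.le)⟩
  obtain ⟨b, ⟨-, hb⟩, hcl⟩ := ((isCompact_closedBall (0 : ModelSpace n) (‖a‖ + 1)).inter_right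
    (isClosed_Ch u)).exists_mapClusterPt_of_frequently hb
  obtain ⟨U, hU, hUb⟩ := mapClusterPt_iff_ultrafilter.1 hcl
  have hd : ∀ z ∈ cs.Ch u, ‖b - z‖ = ‖a - z‖ := fun z hz =>
    tendsto_nhds_unique (hUb.sub_const z).norm ((hconv z hz).mono_left hU)
  rwa [← eq_of_norm_sub_eq hd]

theorem exists_align {f h : ModelSpace n → X} (hf : f ∈ B.charts) (hh : h ∈ B.charts)
    {u u' x y : ModelSpace n} (hu : cs.Reg u) (hu' : cs.Reg u')
    (hpar : Par (h '' {z | z - y ∈ cs.Ch u'}) (f '' {z | z - x ∈ cs.Ch u})) :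
    ∃ h' ∈ B.charts, Asym cs h' f u ∧ ∃ y', h' y' = h y ∧
      h '' {z | z - y ∈ cs.Ch u'} = h' '' {z | z - y' ∈ cs.Ch u} := by
  obtain ⟨L, hL, hpos⟩ := exists_pos hf hh hu hu'
  have hLu : L u' ∈ cs.Ch u := mem_Ch_of_par hf hh (y := y) (v := u')
    (T := h '' {z | z - y ∈ cs.Ch u'}) (fun t ht => mem_image_of_mem _ (by
      rw [mem_ofPred_eq, add_sub_cancel_left]; exact smul_mem_Ch ht (self_mem_Ch u'))) hpar
    (hpos u' (self_mem_Ch u'))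
  have hCh := hu.Ch_eq_of_mem (hu'.map hL) hLu
  have hLi : ∀ x, L (L⁻¹ x) = x := L.apply_symm_apply
  have hiL : ∀ x, L⁻¹ (L x) = x := L.symm_apply_apply
  have hh₁ := B.chart_comp hh (inv_mem hL) 0
  obtain ⟨c, hc⟩ := exists_shift_of_pos hf hh₁ hu fun v hv => by
    have h1 : L⁻¹ v ∈ cs.Ch u' := by rwa [← mem_Ch_map_iff hL, ← hCh]
    have h2 := hpos _ h1
    rw [hLi] at h2
    exact h2.congr (near_reparam hh L⁻¹ 0 v).symm
  refine ⟨_, B.chart_shift hh₁ c, hc, L y - c, by simp [hiL], ?_⟩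
  ext q
  constructor
  · rintro ⟨z, hz, rfl⟩
    refine ⟨L z - c, ?_, by simp [hiL]⟩
    rw [mem_ofPred_eq, sub_sub_sub_cancel_right, ← map_sub, hCh]
    exact map_mem_Ch hL hz
  · rintro ⟨z, hz, rfl⟩
    refine ⟨L⁻¹ (z + c), ?_, by simp⟩
    rw [mem_ofPred_eq, hCh, mem_Ch_map_iff hL] at hz
    rw [mem_ofPred_eq]
    convert hz using 1
    simp only [map_sub, map_add, hiL]
    abel

end RBuilding

end Align

section Openness

open SphericalCoxeterSystem Filter Topology

variable {n : ℕ} {cs : SphericalCoxeterSystem n} {X : Type*} [MetricSpace X] {Λ : Set X}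

namespace RBuilding

variable {B : RBuilding cs X Λ}

/-- Locally coinciding sectors are images of the same model sector under charts agreeing near its
tip. -/
theorem exists_eq_of_locCoin {f : ModelSpace n → X} (hf : f ∈ B.charts) {x u : ModelSpace n}
    (hu : cs.Reg u) {T : Set X} (hT : IsSectorAt cs B.charts (f x) T)
    (h : LocCoin (f x) (f '' {y | y - x ∈ cs.Ch u}) T) :
    ∃ g ∈ B.charts, T = g '' {y | y - x ∈ cs.Ch u} ∧
      ∃ R : ℝ, 0 < R ∧ ∀ v ∈ cs.Ch u, ‖v‖ < R → f (x + v) = g (x + v) := by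
  obtain ⟨g, hg, x', u', hu', hx', rfl⟩ := exists_chart_of_isSectorAt hT
  obtain ⟨R, hR, hball⟩ := Metric.mem_nhdsWithin_iff.1 h.1
  obtain ⟨L, hL, c, hLc⟩ := B.exists_transition hf hg
  have hiL : ∀ x, L⁻¹ (L x) = x := L.symm_apply_apply
  have hLi : ∀ x, L (L⁻¹ x) = x := L.apply_symm_apply
  have hxL : L x + c = x' := inj hg (by rw [← hLc x ⟨x', hx'⟩, hx'])
  have hmem : ∀ v ∈ cs.Ch u, ‖v‖ < R → f (x + v) = g (L (x + v) + c) ∧ L v ∈ cs.Ch u' := by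
    intro v hv hvR
    obtain ⟨y, hy, hyf⟩ := (hball ⟨by
      rw [Metric.mem_ball, (B.isom f hf).dist_eq, dist_eq_norm]; simpa using hvR,
      ⟨x + v, by rw [mem_ofPred_eq, add_sub_cancel_left]; exact hv, rfl⟩⟩ :
      f (x + v) ∈ _ ∩ g '' {y | y - x' ∈ cs.Ch u'}).2
    have h1 := hLc (x + v) ⟨y, hyf⟩
    refine ⟨h1, ?_⟩
    have h2 := inj hg (hyf.trans h1)
    rw [h2, mem_ofPred_eq, ← hxL] at hy
    convert hy using 1
    rw [map_add]
    abel
  have hCh : cs.Ch u = cs.Ch (L⁻¹ u') := by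
    refine ((hu'.map (inv_mem hL)).Ch_eq_of_mem hu ?_).symm
    have hs : 0 < R / (‖u‖ + 1) := by positivity
    rw [mem_Ch_map_iff (inv_mem hL), inv_inv, ← smul_mem_Ch_iff hs, ← map_smul]
    refine (hmem _ (smul_mem_Ch hs.le (self_mem_Ch u)) ?_).2
    rw [norm_smul, Real.norm_of_nonneg hs.le, div_mul_eq_mul_div, div_lt_iff₀ (by positivity)]
    nlinarith
  refine ⟨_, B.chart_comp hg hL c, ?_, R, hR, fun v hv hvR => (hmem v hv hvR).1⟩
  rw [hCh]
  ext q
  constructor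
  · rintro ⟨y, hy, rfl⟩
    refine ⟨L⁻¹ (y - c), ?_, by simp⟩
    rw [mem_ofPred_eq, mem_Ch_map_iff (inv_mem hL), inv_inv, map_sub, hLi]
    rw [mem_ofPred_eq, ← hxL] at hy
    convert hy using 1
    abel
  · rintro ⟨y, hy, rfl⟩
    refine ⟨L y + c, ?_, rfl⟩
    rw [mem_ofPred_eq, mem_Ch_map_iff (inv_mem hL), inv_inv, map_sub] at hy
    rw [mem_ofPred_eq, ← hxL]
    convert hy using 1
    abel

theorem locCoin_of_eq {f g : ModelSpace n → X} (hf : f ∈ B.charts) (hg : g ∈ B.charts)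
    {x u : ModelSpace n} {ε : ℝ} (hε : 0 < ε)
    (h : ∀ v ∈ cs.Ch u, ‖v‖ < ε → f (x + v) = g (x + v)) :
    LocCoin (f x) (f '' {y | y - x ∈ cs.Ch u}) (g '' {y | y - x ∈ cs.Ch u}) := by
  have hx : f x = g x := by simpa using h 0 (zero_mem_Ch u) (by simpa using hε)
  have h' : ∀ y, y - x ∈ cs.Ch u → ‖y - x‖ < ε → f y = g y := fun y hy hyε => by
    simpa using h _ hy hyε
  constructor
  · refine Metric.mem_nhdsWithin_iff.2 ⟨ε, hε, ?_⟩
    rintro _ ⟨hb, y, hy, rfl⟩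
    rw [Metric.mem_ball, (B.isom f hf).dist_eq, dist_eq_norm] at hb
    exact ⟨⟨y, hy, rfl⟩, y, hy, (h' y hy hb).symm⟩
  · refine Metric.mem_nhdsWithin_iff.2 ⟨ε, hε, ?_⟩
    rintro _ ⟨hb, y, hy, rfl⟩
    rw [hx, Metric.mem_ball, (B.isom g hg).dist_eq, dist_eq_norm] at hb
    exact ⟨⟨y, hy, h' y hy hb⟩, y, hy, rfl⟩

/-- If two charts agree near the tip of a sector, sectors parallel to its two images with a common
base point close to the tip locally coincide. -/
theorem exists_locCoin_of_eq {f g : ModelSpace n → X} (hf : f ∈ B.charts) (hg : g ∈ B.charts)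
    {x u : ModelSpace n} (hu : cs.Reg u) {R : ℝ} (hR : 0 < R)
    (hfg : ∀ v ∈ cs.Ch u, ‖v‖ < R → f (x + v) = g (x + v)) :
    ∃ l : ℝ, 0 < l ∧ ∀ h₁ ∈ B.charts, ∀ h₂ ∈ B.charts, Asym cs h₁ f u → Asym cs h₂ g u →
      ∀ y₁ y₂, h₁ y₁ = h₂ y₂ → dist (f x) (h₁ y₁) < l →
      LocCoin (h₁ y₁) (h₁ '' {y | y - y₁ ∈ cs.Ch u}) (h₂ '' {y | y - y₂ ∈ cs.Ch u}) := by
  obtain ⟨M, hM, hdepth⟩ := exists_depth B hu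
  have hx : f x = g x := by simpa using hfg 0 (zero_mem_Ch u) (by simpa using hR)
  set ρ := R / (3 * (‖u‖ + 1)) with hρ
  have hρ0 : 0 < ρ := by positivity
  have hρR : ρ * ‖u‖ < R / 3 := by
    have : ρ * (‖u‖ + 1) = R / 3 := by rw [hρ]; field_simp
    linarith
  refine ⟨ρ / M, by positivity, fun h₁ hh₁ h₂ hh₂ h₁f h₂g y₁ y₂ hy hd => ?_⟩
  have hMd : M * dist (f x) (h₁ y₁) ≤ ρ := by
    rw [lt_div_iff₀ hM] at hd; linarith
  obtain ⟨hmem, h1⟩ := hdepth f hf h₁ hh₁ h₁f x y₁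
  obtain ⟨-, h2⟩ := hdepth g hg h₂ hh₂ h₂g x y₂
  rw [← hx, ← hy] at h2
  set r := M * dist (f x) (h₁ y₁) with hr
  have hr0 : 0 ≤ r := mul_nonneg hM.le dist_nonneg
  have hagree : ∀ w ∈ cs.Ch u, ‖w‖ < R / 3 →
      h₁ (x + r • u + (ρ • u + w)) = h₂ (x + r • u + (ρ • u + w)) := by
    intro w hw hwR
    have hw' := add_mem_Ch (smul_mem_Ch hρ0.le (self_mem_Ch u)) hw
    rw [← h1 _ hw', ← h2 _ hw', add_assoc]
    refine hfg _ (add_mem_Ch (smul_mem_Ch hr0 (self_mem_Ch u)) hw') ?_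
    have e1 := norm_add_le (r • u) (ρ • u + w)
    have e2 := norm_add_le (ρ • u) w
    rw [norm_smul, Real.norm_of_nonneg hr0] at e1
    rw [norm_smul, Real.norm_of_nonneg hρ0.le] at e2
    have e3 := mul_le_mul_of_nonneg_right hMd (norm_nonneg u)
    linarith
  have hc : Coherent h₁ h₂ := coherent_of_germ hh₁ hh₂ (z := x + r • u + ρ • u) (e := u)
    (by positivity : 0 < R / 3) fun w hw hwR => by
      have := hagree w hw hwR
      rwa [← add_assoc] at this
  have hy12 : y₁ = y₂ := inj hh₂ ((hc y₁ ⟨y₂, hy.symm⟩).symm.trans hy)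
  subst hy12
  set u₁ := r • u + (x - y₁) + ρ • u with hu₁
  have hreg : cs.Reg u₁ := hu.add_smul hmem hρ0
  have hCh : cs.Ch u = cs.Ch u₁ := hu.Ch_eq_of_mem hreg
    (add_mem_Ch hmem (smul_mem_Ch hρ0.le (self_mem_Ch u)))
  obtain ⟨ε, hε, h⟩ := eq_germ_of_eq_interior hh₁ hh₂ hreg hy (by positivity : 0 < R / 3)
    fun w hw hwR => by
      have := hagree w (hCh ▸ hw) hwR
      rwa [show x + r • u + (ρ • u + w) = y₁ + u₁ + w by rw [hu₁]; abel] at this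
  rw [← hCh] at h
  exact locCoin_of_eq hh₁ hh₂ hε h

end RBuilding

end Openness

/-- **Corollary 7.** If two adjacent chambers at infinity `C_∞`, `D_∞`
(represented by sectors `C₀`, `D₀`) have sectors `C_β`, `D_β` based at `β` with the
same germ, then the same holds at every point `γ` sufficiently close to `β`. -/
theorem germ_equality_is_open
    {n : ℕ} (cs : SphericalCoxeterSystem n) {X : Type*} [MetricSpace X]
    {Λ : Set X} (B : RBuilding cs X Λ)
    (C₀ D₀ : Set X) (hC₀ : IsSector cs B.charts C₀) (hD₀ : IsSector cs B.charts D₀)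
    (hadj : AdjacentChambers cs B.charts C₀ D₀)
    (β : X) (hβ : β ∈ Λ)
    (Cβ Dβ : Set X)
    (hCβ : IsSectorAt cs B.charts β Cβ) (hCβpar : Par Cβ C₀)
    (hDβ : IsSectorAt cs B.charts β Dβ) (hDβpar : Par Dβ D₀)
    (hgerm : LocCoin β Cβ Dβ) :
    ∃ l : ℝ, 0 < l ∧ ∀ γ ∈ Λ, dist β γ < l →
      ∀ Cγ Dγ : Set X,
        IsSectorAt cs B.charts γ Cγ → Par Cγ C₀ →
        IsSectorAt cs B.charts γ Dγ → Par Dγ D₀ →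
        LocCoin γ Cγ Dγ := by

  obtain ⟨f, hf, x, u, hu, rfl, rfl⟩ := RBuilding.exists_chart_of_isSectorAt hCβ
  obtain ⟨g, hg, rfl, R, hR, hfg⟩ := RBuilding.exists_eq_of_locCoin hf hu hDβ hgerm
  obtain ⟨l, hl, H⟩ := RBuilding.exists_locCoin_of_eq hf hg hu hR hfg
  refine ⟨l, hl, fun γ _ hγ Cγ Dγ hCγ hCγpar hDγ hDγpar => ?_⟩
  obtain ⟨h₁, hh₁, y₁, u₁, hu₁, rfl, rfl⟩ := RBuilding.exists_chart_of_isSectorAt hCγ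
  obtain ⟨h₂, hh₂, y₂, u₂, hu₂, hy, rfl⟩ := RBuilding.exists_chart_of_isSectorAt hDγ
  obtain ⟨k₁, hk₁, hkf, z₁, hz₁, he₁⟩ :=
    RBuilding.exists_align hf hh₁ hu hu₁ (hCγpar.trans hCβpar.symm)
  obtain ⟨k₂, hk₂, hkg, z₂, hz₂, he₂⟩ :=
    RBuilding.exists_align hg hh₂ hu hu₂ (hDγpar.trans hDβpar.symm)
  rw [he₁, he₂, ← hz₁]
  exact H k₁ hk₁ k₂ hk₂ hkf hkg z₁ z₂ (by rw [hz₁, hz₂, hy]) (by rwa [hz₁])
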